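/- Let p be a prime number with p ≡ 1 (mod 24) such that there exists z ∈ 𝔽_p with z⁴ = 2 but there is no w ∈ 𝔽_p with w⁴ − 2w² − 2 = 0 (equivalently: p splits completely in ℚ(2^{1/4}) and not in ℚ(√(1+√3))). Then every rational solution (x, y) ∈ ℚ × ℚ of y² = x(x² − p²)(x² − 4p²) satisfies y = 0 (hence x ∈ {0, p, −p, 2p, −2p}). -/

import Mathlib

/-- The coefficients that occur in the descents: `1` and the primes congruent to `1` modulo
`24`. -/
def Admissible (n : ℤ) : Prop := 0 < n ∧ n % 24 = 1 ∧ (n = 1 ∨ Prime n)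

theorem Admissible.one : Admissible 1 := ⟨by norm_num, by norm_num, Or.inl rfl⟩

theorem Admissible.of_nat_prime {p : ℕ} (hp : p.Prime) (h : p % 24 = 1) :
    Admissible (p : ℤ) :=
  ⟨by exact_mod_cast hp.pos, by exact_mod_cast h, Or.inr (Nat.prime_iff_prime_int.mp hp)⟩

/-- If `x * y` is `n` times a nonzero square and all primes dividing both `x` and `y` divide the
divisor `D` of `6`, then `x` is a divisor of `D` times a divisor of `n` times a square. -/
theorem exists_eq_mul_sq_of_mul_eq {n x y w D : ℤ} (hn : Admissible n) (hD : D ∣ 6)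
    (h : x * y = n * w ^ 2) (hw : w ≠ 0)
    (hc : ∀ q : ℤ, Prime q → q ∣ x → q ∣ y → q ∣ D) :
    ∃ d m z : ℤ, x = d * m * z ^ 2 ∧ d ∣ D ∧ (m = 1 ∨ m = n) := by
  have hn0 : n ≠ 0 := hn.1.ne'
  have hD0 : D ≠ 0 := by rintro rfl; simp at hD
  have hxy : x * y ≠ 0 := by rw [h]; positivity
  have hx : x ≠ 0 := left_ne_zero_of_mul hxy
  have hy : y ≠ 0 := right_ne_zero_of_mul hxy
  obtain ⟨a, b, hab, hsq⟩ := Nat.sq_mul_squarefree x.natAbs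
  have hb0 : b ≠ 0 := by rintro rfl; simp at hab; omega
  have ha0 : a ≠ 0 := by rintro rfl; simp at hab; omega
  have key : ∀ q : ℕ, q.Prime → q ∣ a → q ∣ D.natAbs * n.natAbs := by
    intro q hq hqa
    by_contra hcon
    have hqD : ¬ (q : ℤ) ∣ D := fun hh =>
      hcon (Dvd.dvd.mul_right (Int.natCast_dvd.mp hh) _)
    have hqn : ¬ (q : ℤ) ∣ n := fun hh =>
      hcon (Dvd.dvd.mul_left (Int.natCast_dvd.mp hh) _)
    have hqx : (q : ℤ) ∣ x := by
      rw [Int.natCast_dvd, ← hab]; exact Dvd.dvd.mul_left hqa _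
    have hqy : ¬ (q : ℤ) ∣ y := fun hh => hqD (hc q (Nat.prime_iff_prime_int.mp hq) hqx hh)
    have : Fact q.Prime := ⟨hq⟩
    have h1 : padicValInt q (x * y) = padicValInt q (n * w ^ 2) := by rw [h]
    rw [padicValInt.mul hx hy, pow_two, padicValInt.mul hn0 (mul_ne_zero hw hw),
      padicValInt.mul hw hw, padicValInt.eq_zero_of_not_dvd hqy,
      padicValInt.eq_zero_of_not_dvd hqn, padicValInt, ← hab, pow_two,
      padicValNat.mul (mul_ne_zero hb0 hb0) ha0, padicValNat.mul hb0 hb0] at h1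
    have h2 : padicValNat q a = 1 := by
      have h3 : 1 ≤ padicValNat q a := one_le_padicValNat_of_dvd ha0 hqa
      have h4 : padicValNat q a < 2 := by
        by_contra h5
        have h6 : q ^ 2 ∣ a := (padicValNat_dvd_iff_le ha0).mpr (by omega)
        have := hsq q (by rwa [pow_two] at h6)
        exact hq.one_lt.ne' (Nat.isUnit_iff.mp this)
      omega
    omega
  have hdvd : a ∣ D.natAbs * n.natAbs := by
    rw [← Nat.prod_primeFactors_of_squarefree hsq]
    refine Finset.prod_primes_dvd _ (fun q hq => (Nat.prime_of_mem_primeFactors hq).prime) ?_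
    exact fun q hq => key q (Nat.prime_of_mem_primeFactors hq) (Nat.dvd_of_mem_primeFactors hq)
  obtain ⟨d, m, hd, hm, hdm⟩ := (Nat.dvd_mul).mp hdvd
  have hm' : (m : ℤ) = 1 ∨ (m : ℤ) = n := by
    rcases hn.2.2 with h1 | h1
    · subst h1; left; simpa using hm
    · rcases (Nat.dvd_prime (Int.prime_iff_natAbs_prime.mp h1)).mp hm with h2 | h2
      · left; exact_mod_cast h2
      · right; have := hn.1; omega
  have hd' : (d : ℤ) ∣ D := Int.natCast_dvd.mpr hd
  have habs : |x| = d * m * (b : ℤ) ^ 2 := by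
    rw [Int.abs_eq_natAbs, ← hab, ← hdm]; push_cast; ring
  rcases abs_choice x with h1 | h1
  · exact ⟨d, m, b, by rw [← h1, habs], hd', hm'⟩
  · exact ⟨-d, m, b, by rw [← neg_neg x, ← h1, habs]; ring, by simpa using hd', hm'⟩

theorem dvd_of_sq_dvd_mul_sq {k a z : ℤ} (hk : Squarefree k) (h : a ^ 2 ∣ k * z ^ 2) :
    a ∣ z := by
  by_cases hz : z = 0
  · simp [hz]
  have hg : Int.gcd a z ≠ 0 := by simp [hz]
  obtain ⟨a', z', hco, ha, hz'⟩ := Int.exists_gcd_one (Nat.pos_of_ne_zero hg)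
  have hg' : ((Int.gcd a z : ℤ)) ≠ 0 := by exact_mod_cast hg
  generalize (Int.gcd a z : ℤ) = c at ha hz' hg'
  rw [ha, hz', mul_pow, mul_pow, ← mul_assoc,
    mul_dvd_mul_iff_right (pow_ne_zero 2 hg')] at h
  have hco' : IsCoprime (a' ^ 2) (z' ^ 2) := (Int.isCoprime_iff_gcd_eq_one.mpr hco).pow
  have h2 : a' ^ 2 ∣ k := hco'.dvd_of_dvd_mul_right h
  have h3 : IsUnit a' := hk a' (by rwa [pow_two] at h2)
  rw [ha, hz']
  exact mul_dvd_mul_right h3.dvd _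

theorem Admissible.squarefree {n : ℤ} (hn : Admissible n) : Squarefree n := by
  rcases hn.2.2 with h | h
  · subst h; exact squarefree_one
  · exact h.squarefree

theorem squarefree_of_dvd_six {D : ℤ} (hD : D ∣ 6) : Squarefree D := by
  refine Squarefree.squarefree_of_dvd hD ?_
  rw [← Int.squarefree_natAbs]
  exact (Nat.squarefree_mul (m := 2) (n := 3) (by norm_num)).mpr
    ⟨Nat.prime_two.squarefree, Nat.prime_three.squarefree⟩

theorem Admissible.isCoprime_six {n : ℤ} (hn : Admissible n) : IsCoprime n 6 :=
  ⟨1, -(n / 6), by have := hn.2.1; omega⟩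

/-- Solving for the last factor of a product that is `m` times a square. -/
theorem exists_eq_of_mul_sq_eq {v D Z m w : ℤ} (hm : Admissible m) (hD : D ∣ 6) (hZ : Z ≠ 0)
    (h : v * D * Z ^ 2 = m * w ^ 2) : ∃ y, v = D * m * y ^ 2 := by
  have hD0 : D ≠ 0 := by rintro rfl; simp at hD
  obtain ⟨w1, rfl⟩ : Z ∣ w := dvd_of_sq_dvd_mul_sq hm.squarefree (Dvd.intro_left _ h)
  have h1 : v * D = m * w1 ^ 2 := by
    apply mul_right_cancel₀ (pow_ne_zero 2 hZ); linarith [h]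
  have h2 : D ∣ w1 ^ 2 := (hm.isCoprime_six.symm.of_isCoprime_of_dvd_left hD).dvd_of_dvd_mul_left
    (Dvd.intro_left _ h1)
  obtain ⟨y, rfl⟩ : D ∣ w1 := (squarefree_of_dvd_six hD).isRadical 2 w1 h2
  exact ⟨y, mul_right_cancel₀ hD0 (by linarith [h1])⟩

/-- An integer all of whose prime divisors `q ≥ 5` have `p` as a quadratic residue is a square
modulo `p`. -/
theorem isSquare_intCast_of_forall_prime {p : ℕ} [Fact p.Prime] (hmod : p % 24 = 1) {x : ℤ}
    (hx : ∀ q : ℕ, Fact q.Prime → (2 : ZMod q) ≠ 0 → (3 : ZMod q) ≠ 0 → (x : ZMod q) = 0 →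
      IsSquare (p : ZMod q)) :
    IsSquare (x : ZMod p) := by
  have hp := Fact.out (p := p.Prime)
  have hneg : IsSquare (-1 : ZMod p) := ZMod.exists_sq_eq_neg_one_iff.mpr (by omega)
  have h2 : IsSquare (2 : ZMod p) := (ZMod.exists_sq_eq_two_iff (by omega)).mpr (by omega)
  have h3 : IsSquare ((3 : ℕ) : ZMod p) := by
    have : Fact (Nat.Prime 3) := ⟨Nat.prime_three⟩
    rw [ZMod.exists_sq_eq_prime_iff_of_mod_four_eq_one (by omega) (by norm_num)]
    have : (p : ZMod 3) = ((1 : ℕ) : ZMod 3) := by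
      rw [ZMod.natCast_eq_natCast_iff']; omega
    rw [this]; simp
  have hne : ∀ q l : ℕ, q.Prime → l.Prime → q ≠ l → (l : ZMod q) ≠ 0 := by
    intro q l hq hl hql h0
    rw [ZMod.natCast_eq_zero_iff] at h0
    exact hql ((Nat.prime_dvd_prime_iff_eq hq hl).mp h0)
  have main : ∀ k : ℕ, (k : ℤ) ∣ x → IsSquare (k : ZMod p) := by
    intro k
    induction k using Nat.recOnMul with
    | zero => intro _; simp
    | one => intro _; simp
    | prime q hq =>
      intro hqx
      by_cases hq2 : q = 2
      · subst hq2; exact_mod_cast h2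
      by_cases hq3 : q = 3
      · subst hq3; exact h3
      have : Fact q.Prime := ⟨hq⟩
      rw [ZMod.exists_sq_eq_prime_iff_of_mod_four_eq_one (by omega) hq2]
      exact hx q ⟨hq⟩ (by exact_mod_cast hne q 2 hq Nat.prime_two hq2)
        (by exact_mod_cast hne q 3 hq Nat.prime_three hq3)
        ((ZMod.intCast_zmod_eq_zero_iff_dvd _ _).mpr hqx)
    | mul a b iha ihb =>
      intro hab
      push_cast at hab ⊢
      exact (iha (dvd_of_mul_right_dvd hab)).mul (ihb (dvd_of_mul_left_dvd hab))
  have h1 := main x.natAbs (by simp)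
  rcases Int.natAbs_eq x with h | h
  · rw [h]; simpa using h1
  · rw [h]; push_cast; rw [← neg_one_mul]; exact hneg.mul (by simpa using h1)

theorem isSquare_of_mul_sq_eq {F : Type*} [Field F] {P f g : F} (hf : f ≠ 0)
    (h : P * f ^ 2 = g ^ 2) : IsSquare P :=
  ⟨g / f, by field_simp; linear_combination h⟩

theorem IsCoprime.zmod_ne_zero {x y : ℤ} (h : IsCoprime x y) (q : ℕ) [Fact q.Prime] :
    (x : ZMod q) ≠ 0 ∨ (y : ZMod q) ≠ 0 := by
  by_contra! hcon
  obtain ⟨u, v, huv⟩ := h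
  have := congrArg (Int.cast : ℤ → ZMod q) huv
  push_cast at this
  rw [hcon.1, hcon.2] at this
  simp at this

/-- Coprime integers whose product is a square are, up to a common sign, squares. -/
theorem exists_sq_of_coprime_of_mul_eq_sq {U V k : ℤ} (hc : IsCoprime U V) (h : U * V = k ^ 2) :
    ∃ s u v : ℤ, (s = 1 ∨ s = -1) ∧ U = s * u ^ 2 ∧ V = s * v ^ 2 := by
  obtain ⟨u, hu⟩ := Int.sq_of_isCoprime hc h
  obtain ⟨v, hv⟩ := Int.sq_of_isCoprime hc.symm (by rw [mul_comm, h])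
  have hopp : -(u * v) ^ 2 = k ^ 2 → u = 0 ∨ v = 0 := by
    intro h1
    have h2 : (u * v) ^ 2 = 0 := by nlinarith [sq_nonneg (u * v), sq_nonneg k]
    exact mul_eq_zero.mp (pow_eq_zero_iff (two_ne_zero) |>.mp h2)
  rcases hu with hu | hu <;> rcases hv with hv | hv
  · exact ⟨1, u, v, Or.inl rfl, by linarith, by linarith⟩
  · rcases hopp (by rw [← h, hu, hv]; ring) with h0 | h0
    · exact ⟨-1, u, v, Or.inr rfl, by rw [hu, h0]; ring, by linarith⟩
    · exact ⟨1, u, v, Or.inl rfl, by linarith, by rw [hv, h0]; ring⟩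
  · rcases hopp (by rw [← h, hu, hv]; ring) with h0 | h0
    · exact ⟨1, u, v, Or.inl rfl, by rw [hu, h0]; ring, by linarith⟩
    · exact ⟨-1, u, v, Or.inr rfl, by linarith, by rw [hv, h0]; ring⟩
  · exact ⟨-1, u, v, Or.inr rfl, by linarith, by linarith⟩

theorem exists_sq_of_coprime_of_mul_eq_prime_mul_sq {U V k q : ℤ} (hq : Prime q)
    (hc : IsCoprime U V) (h : U * V = q * k ^ 2) :
    ∃ s u v : ℤ, (s = 1 ∨ s = -1) ∧
      ((U = s * (q * u ^ 2) ∧ V = s * v ^ 2) ∨ (U = s * u ^ 2 ∧ V = s * (q * v ^ 2))) := by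
  rcases hq.dvd_or_dvd (Dvd.intro _ h.symm) with ⟨W, hW⟩ | ⟨W, hW⟩
  · obtain ⟨s, u, v, hs, hu, hv⟩ := exists_sq_of_coprime_of_mul_eq_sq (U := W) (V := V) (k := k)
      (hc.of_isCoprime_of_dvd_left ⟨q, by rw [hW]; ring⟩)
      (mul_left_cancel₀ hq.ne_zero (by rw [← h, hW]; ring))
    exact ⟨s, u, v, hs, Or.inl ⟨by rw [hW, hu]; ring, hv⟩⟩
  · obtain ⟨s, u, v, hs, hu, hv⟩ := exists_sq_of_coprime_of_mul_eq_sq (U := U) (V := W) (k := k)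
      (hc.of_isCoprime_of_dvd_right ⟨q, by rw [hW]; ring⟩)
      (mul_left_cancel₀ hq.ne_zero (by rw [← h, hW]; ring))
    exact ⟨s, u, v, hs, Or.inr ⟨hu, by rw [hW, hv]; ring⟩⟩

theorem isSquare_intCast_of_dvd_six {p : ℕ} [Fact p.Prime] (hmod : p % 24 = 1) {d : ℤ}
    (hd : d ∣ 6) : IsSquare (d : ZMod p) := by
  refine isSquare_intCast_of_forall_prime hmod fun q _ h2 h3 hx => ?_
  obtain ⟨e, he⟩ := hd
  have := congrArg (Int.cast : ℤ → ZMod q) he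
  push_cast at this
  rw [hx, zero_mul] at this
  exact absurd (by linear_combination this : (2 : ZMod q) * 3 = 0) (mul_ne_zero h2 h3)

theorem zmod_two_three_ne_zero {p : ℕ} [Fact p.Prime] (hmod : p % 24 = 1) :
    (2 : ZMod p) ≠ 0 ∧ (3 : ZMod p) ≠ 0 := by
  have hp := Fact.out (p := p.Prime)
  constructor
  · intro h
    have : p ∣ 2 := by rw [← ZMod.natCast_eq_zero_iff]; exact_mod_cast h
    have := Nat.le_of_dvd (by norm_num) this
    have := hp.two_le
    omega
  · intro h
    have : p ∣ 3 := by rw [← ZMod.natCast_eq_zero_iff]; exact_mod_cast h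
    have := Nat.le_of_dvd (by norm_num) this
    have := hp.two_le
    omega

theorem exists_root_of_sq_eq_three_mul_sq {p : ℕ} [Fact p.Prime] {x y : ZMod p} (hy : y ≠ 0)
    (h : x ^ 2 = 3 * y ^ 2) (hxy : IsSquare (x + y)) (hsy : IsSquare y) :
    ∃ w : ZMod p, w ^ 4 - 2 * w ^ 2 - 2 = 0 := by
  obtain ⟨u, hu⟩ := hxy
  obtain ⟨v, hv⟩ := hsy
  have hv0 : v ≠ 0 := by rintro rfl; simp at hv; exact hy hv
  refine ⟨u / v, ?_⟩
  have h1 : u ^ 2 = x + y := by rw [hu]; ring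
  have h2 : v ^ 2 = y := by rw [hv]; ring
  have h3 : u ^ 4 = (x + y) ^ 2 := by rw [← h1]; ring
  have h4 : v ^ 4 = y ^ 2 := by rw [← h2]; ring
  have h5 : (u / v) ^ 4 - 2 * (u / v) ^ 2 - 2 = (u ^ 4 - 2 * u ^ 2 * v ^ 2 - 2 * v ^ 4) / v ^ 4 := by
    field_simp
  rw [h5, h1, h2, h3, h4, div_eq_zero_iff]
  left
  linear_combination h

theorem exists_root_of_sq_eq_neg_two_mul_sq {p : ℕ} [Fact p.Prime] (hmod : p % 24 = 1)
    {x y : ZMod p} (hy : y ≠ 0)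
    (h : x ^ 2 = -2 * y ^ 2) (hxy : IsSquare (x + y)) (hsy : IsSquare y) :
    ∃ w : ZMod p, w ^ 4 - 2 * w ^ 2 - 2 = 0 := by
  obtain ⟨u, hu⟩ := hxy
  obtain ⟨v, hv⟩ := hsy
  obtain ⟨θ, hθ⟩ := isSquare_intCast_of_dvd_six (p := p) hmod (d := 3) (by norm_num)
  obtain ⟨κ, hκ⟩ := isSquare_intCast_of_dvd_six (p := p) hmod (d := 2) (by norm_num)
  obtain ⟨h2, h3⟩ := zmod_two_three_ne_zero (p := p) hmod
  push_cast at hθ hκ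
  have hv0 : v ≠ 0 := by grind
  have hu0 : u ≠ 0 := by
    rintro rfl
    have h5 : x = -y := by linear_combination hu
    rw [h5] at h
    have h4 : 3 * y ^ 2 = 0 := by linear_combination h
    simp [h3, hy] at h4
  have hκ0 : κ ≠ 0 := by grind
  have ht : (u / v) ^ 2 = 1 + x / y := by
    rw [div_pow, pow_two, pow_two, ← hu, ← hv]
    field_simp
    ring
  have hinv : (θ * v / u) ^ 2 = 1 - x / y := by
    have h1 : (1 + x / y) * (1 - x / y) = 3 := by
      field_simp; linear_combination -h
    have h5 : (u / v) ^ 2 ≠ 0 := by positivity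
    apply mul_left_cancel₀ h5
    rw [ht, h1, ← ht]
    field_simp
    linear_combination -hθ
  have hw : ((u / v + θ * v / u) / κ) ^ 2 = 1 + θ := by
    have h5 : (u / v + θ * v / u) ^ 2 = 2 + 2 * θ := by
      have h6 : u / v * (θ * v / u) = θ := by field_simp
      linear_combination ht + hinv + 2 * h6
    rw [div_pow, h5, pow_two, ← hκ]
    field_simp
  refine ⟨(u / v + θ * v / u) / κ, ?_⟩
  have : ((u / v + θ * v / u) / κ) ^ 4 = (1 + θ) ^ 2 := by rw [← hw]; ring
  rw [this, hw]
  linear_combination -hθ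

theorem IsCoprime.of_forall_prime {x y : ℤ} (h0 : x ≠ 0 ∨ y ≠ 0)
    (h : ∀ q : ℤ, Prime q → q ∣ x → q ∣ y → False) : IsCoprime x y := by
  refine isCoprime_of_prime_dvd (by tauto) fun q hq hx hy => h q hq hx hy

theorem eq_zero_of_two_three_mul {F : Type*} [Field F] (h2 : (2 : F) ≠ 0) (h3 : (3 : F) ≠ 0)
    {x : F} (h : 2 ^ 6 * 3 ^ 4 * x ^ 2 = 0) : x = 0 := by
  simpa [h2, h3] using h

theorem obstruction_aux₁ {p : ℕ} [Fact p.Prime] (hmod : p % 24 = 1)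
    (hr : ¬∃ w : ZMod p, w ^ 4 - 2 * w ^ 2 - 2 = 0) {u v e f : ℤ} (hc : IsCoprime u v)
    (h1 : u ^ 2 + v ^ 2 = p * e ^ 2) (h2 : u ^ 2 + 9 * v ^ 2 = f ^ 2) : False := by
  have E : ∀ q : ℕ, Fact q.Prime → ((u : ZMod q) ^ 2 + v ^ 2 = p * e ^ 2 ∧
      (u : ZMod q) ^ 2 + 9 * v ^ 2 = f ^ 2) ∧ ((u : ZMod q) ≠ 0 ∨ (v : ZMod q) ≠ 0) :=
    fun q _ => ⟨⟨by exact_mod_cast congrArg (Int.cast : ℤ → ZMod q) h1,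
      by exact_mod_cast congrArg (Int.cast : ℤ → ZMod q) h2⟩, hc.zmod_ne_zero q⟩
  have s1 : IsSquare ((f + 2 * u : ℤ) : ZMod p) := by
    refine isSquare_intCast_of_forall_prime hmod fun q _ h2 h3 hx => ?_
    push_cast at hx
    obtain ⟨⟨e1, e2⟩, e3⟩ := E q inferInstance
    refine isSquare_of_mul_sq_eq (f := 3 * (e : ZMod q)) (g := 6 * v) (fun h0 => ?_) (by
      linear_combination -9 * e1 - 3 * e2 - 3 * (f - 2 * u) * hx)
    have hu : (u : ZMod q) = 0 := eq_zero_of_two_three_mul h2 h3 (by clear * - h0 e1 e2 hx; grind)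
    have hv : (v : ZMod q) = 0 := eq_zero_of_two_three_mul h2 h3 (by clear * - h0 e1 e2 hx; grind)
    exact e3.elim (· hu) (· hv)
  have s2 : IsSquare ((2 * u : ℤ) : ZMod p) := by
    refine isSquare_intCast_of_forall_prime hmod fun q _ h2 h3 hx => ?_
    push_cast at hx
    obtain ⟨⟨e1, e2⟩, e3⟩ := E q inferInstance
    have hu : (u : ZMod q) = 0 := by simpa [h2] using hx
    rw [hu] at e1 e2
    refine isSquare_of_mul_sq_eq (f := (e : ZMod q)) (g := v) (fun h0 => ?_) (by
      linear_combination -e1)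
    have hv : (v : ZMod q) = 0 := eq_zero_of_two_three_mul h2 h3 (by clear * - h0 e1; grind)
    exact e3.elim (· hu) (· hv)
  obtain ⟨⟨e1, e2⟩, e3⟩ := E p inferInstance
  obtain ⟨t2, t3⟩ := zmod_two_three_ne_zero (p := p) hmod
  rw [CharP.cast_eq_zero, zero_mul] at e1
  push_cast at s1 s2
  refine hr (exists_root_of_sq_eq_neg_two_mul_sq hmod (x := (f : ZMod p)) (y := 2 * u) ?_ ?_
    s1 s2)
  · intro h0
    have hu : (u : ZMod p) = 0 := by simpa [t2] using h0
    have hv : (v : ZMod p) = 0 := eq_zero_of_two_three_mul t2 t3 (by clear * - hu e1; grind)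
    exact e3.elim (· hu) (· hv)
  · clear * - e1 e2; grind

theorem obstruction_aux₂ {p : ℕ} [Fact p.Prime] (hmod : p % 24 = 1)
    (hr : ¬∃ w : ZMod p, w ^ 4 - 2 * w ^ 2 - 2 = 0) {u v e f : ℤ} (hc : IsCoprime u v)
    (h1 : u ^ 2 + v ^ 2 = f ^ 2) (h2 : u ^ 2 + 9 * v ^ 2 = p * e ^ 2) : False := by
  have E : ∀ q : ℕ, Fact q.Prime → ((u : ZMod q) ^ 2 + v ^ 2 = f ^ 2 ∧
      (u : ZMod q) ^ 2 + 9 * v ^ 2 = p * e ^ 2) ∧ ((u : ZMod q) ≠ 0 ∨ (v : ZMod q) ≠ 0) :=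
    fun q _ => ⟨⟨by exact_mod_cast congrArg (Int.cast : ℤ → ZMod q) h1,
      by exact_mod_cast congrArg (Int.cast : ℤ → ZMod q) h2⟩, hc.zmod_ne_zero q⟩
  have s1 : IsSquare ((f + 2 * v : ℤ) : ZMod p) := by
    refine isSquare_intCast_of_forall_prime hmod fun q _ h2 h3 hx => ?_
    push_cast at hx
    obtain ⟨⟨e1, e2⟩, e3⟩ := E q inferInstance
    refine isSquare_of_mul_sq_eq (f := (e : ZMod q)) (g := 2 * u) (fun h0 => ?_) (by
      linear_combination -e2 - 3 * e1 - 3 * (f - 2 * v) * hx)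
    have hu : (u : ZMod q) = 0 := eq_zero_of_two_three_mul h2 h3 (by clear * - h0 e1 e2 hx; grind)
    have hv : (v : ZMod q) = 0 := eq_zero_of_two_three_mul h2 h3 (by clear * - h0 e1 e2 hx; grind)
    exact e3.elim (· hu) (· hv)
  have s2 : IsSquare ((2 * v : ℤ) : ZMod p) := by
    refine isSquare_intCast_of_forall_prime hmod fun q _ h2 h3 hx => ?_
    push_cast at hx
    obtain ⟨⟨e1, e2⟩, e3⟩ := E q inferInstance
    have hv : (v : ZMod q) = 0 := by simpa [h2] using hx
    rw [hv] at e1 e2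
    refine isSquare_of_mul_sq_eq (f := (e : ZMod q)) (g := u) (fun h0 => ?_) (by
      linear_combination -e2)
    have hu : (u : ZMod q) = 0 := eq_zero_of_two_three_mul h2 h3 (by clear * - h0 e2; grind)
    exact e3.elim (· hu) (· hv)
  obtain ⟨⟨e1, e2⟩, e3⟩ := E p inferInstance
  obtain ⟨t2, t3⟩ := zmod_two_three_ne_zero (p := p) hmod
  rw [CharP.cast_eq_zero, zero_mul] at e2
  push_cast at s1 s2
  refine hr (exists_root_of_sq_eq_neg_two_mul_sq hmod (x := (f : ZMod p)) (y := 2 * v) ?_ ?_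
    s1 s2)
  · intro h0
    have hv : (v : ZMod p) = 0 := by simpa [t2] using h0
    have hu : (u : ZMod p) = 0 := eq_zero_of_two_three_mul t2 t3 (by clear * - hv e2; grind)
    exact e3.elim (· hu) (· hv)
  · clear * - e1 e2; grind

theorem obstruction_aux₃ {p : ℕ} [Fact p.Prime] (hmod : p % 24 = 1)
    (hr : ¬∃ w : ZMod p, w ^ 4 - 2 * w ^ 2 - 2 = 0) {k l e f : ℤ} (hc : IsCoprime k l)
    (h1 : k ^ 2 + k * l + l ^ 2 = p * e ^ 2) (h2 : k ^ 2 - k * l + l ^ 2 = f ^ 2) : False := by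
  have E : ∀ q : ℕ, Fact q.Prime → ((k : ZMod q) ^ 2 + k * l + l ^ 2 = p * e ^ 2 ∧
      (k : ZMod q) ^ 2 - k * l + l ^ 2 = f ^ 2) ∧ ((k : ZMod q) ≠ 0 ∨ (l : ZMod q) ≠ 0) :=
    fun q _ => ⟨⟨by exact_mod_cast congrArg (Int.cast : ℤ → ZMod q) h1,
      by exact_mod_cast congrArg (Int.cast : ℤ → ZMod q) h2⟩, hc.zmod_ne_zero q⟩
  have s1 : IsSquare ((f + (k + l) : ℤ) : ZMod p) := by
    refine isSquare_intCast_of_forall_prime hmod fun q _ h2 h3 hx => ?_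
    push_cast at hx
    obtain ⟨⟨e1, e2⟩, e3⟩ := E q inferInstance
    refine isSquare_of_mul_sq_eq (f := 3 * (e : ZMod q)) (g := 3 * (k + l)) (fun h0 => ?_) (by
      linear_combination -9 * e1 + 3 * (e2 + (f - k - l) * hx))
    have hkl : 3 * ((k : ZMod q) * l) = 0 := by linear_combination -e2 - (f - k - l) * hx
    have he : (e : ZMod q) = 0 := by simpa [h3] using h0
    rw [he] at e1
    rcases mul_eq_zero.mp ((mul_eq_zero.mp hkl).resolve_left h3) with hk | hk <;> rw [hk] at e1
    · exact e3.elim (· hk) (· (by simpa using e1))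
    · exact e3.elim (· (by simpa using e1)) (· hk)
  have s2 : IsSquare ((k + l : ℤ) : ZMod p) := by
    refine isSquare_intCast_of_forall_prime hmod fun q _ h2 h3 hx => ?_
    push_cast at hx
    obtain ⟨⟨e1, e2⟩, e3⟩ := E q inferInstance
    refine isSquare_of_mul_sq_eq (f := (e : ZMod q)) (g := k) (fun h0 => ?_) (by
      linear_combination -e1 + l * hx)
    have hk : (k : ZMod q) = 0 := eq_zero_of_two_three_mul h2 h3 (by clear * - h0 e1 hx; grind)
    exact e3.elim (· hk) (· (by simpa [hk] using hx))
  obtain ⟨⟨e1, e2⟩, e3⟩ := E p inferInstance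
  obtain ⟨t2, t3⟩ := zmod_two_three_ne_zero (p := p) hmod
  rw [CharP.cast_eq_zero, zero_mul] at e1
  push_cast at s1 s2
  refine hr (exists_root_of_sq_eq_neg_two_mul_sq hmod (x := (f : ZMod p)) (y := k + l) ?_ ?_
    s1 s2)
  · intro h0
    have hk : (k : ZMod p) = 0 := eq_zero_of_two_three_mul t2 t3 (by clear * - h0 e1; grind)
    exact e3.elim (· hk) (· (by simpa [hk] using h0))
  · linear_combination -e2 + 3 * e1

theorem obstruction_aux₄ {p : ℕ} [Fact p.Prime] (hmod : p % 24 = 1)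
    (hr : ¬∃ w : ZMod p, w ^ 4 - 2 * w ^ 2 - 2 = 0) {k l e f : ℤ} (hc : IsCoprime k l)
    (h1 : k ^ 2 + 4 * k * l + l ^ 2 = p * e ^ 2) (h2 : k ^ 2 - 4 * k * l + l ^ 2 = f ^ 2) :
    False := by
  have E : ∀ q : ℕ, Fact q.Prime → ((k : ZMod q) ^ 2 + 4 * k * l + l ^ 2 = p * e ^ 2 ∧
      (k : ZMod q) ^ 2 - 4 * k * l + l ^ 2 = f ^ 2) ∧ ((k : ZMod q) ≠ 0 ∨ (l : ZMod q) ≠ 0) :=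
    fun q _ => ⟨⟨by exact_mod_cast congrArg (Int.cast : ℤ → ZMod q) h1,
      by exact_mod_cast congrArg (Int.cast : ℤ → ZMod q) h2⟩, hc.zmod_ne_zero q⟩
  have s1 : IsSquare ((f : ℤ) : ZMod p) := by
    refine isSquare_intCast_of_forall_prime hmod fun q _ h2 h3 hx => ?_
    obtain ⟨⟨e1, e2⟩, e3⟩ := E q inferInstance
    refine isSquare_of_mul_sq_eq (f := (e : ZMod q)) (g := 2 * (k - l)) (fun h0 => ?_) (by
      linear_combination -e1 - 3 * e2 - 3 * f * hx)
    have hkl : 2 * (2 * (2 * ((k : ZMod q) * l))) = 0 := by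
      linear_combination e1 + p * e * h0 - e2 - f * hx
    rw [h0] at e1
    rcases mul_eq_zero.mp ((mul_eq_zero.mp ((mul_eq_zero.mp ((mul_eq_zero.mp hkl).resolve_left
      h2)).resolve_left h2)).resolve_left h2) with hk | hk <;> rw [hk] at e1
    · exact e3.elim (· hk) (· (by simpa using e1))
    · exact e3.elim (· (by simpa using e1)) (· hk)
  have s2 : IsSquare ((l : ℤ) : ZMod p) := by
    refine isSquare_intCast_of_forall_prime hmod fun q _ h2 h3 hx => ?_
    obtain ⟨⟨e1, e2⟩, e3⟩ := E q inferInstance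
    refine isSquare_of_mul_sq_eq (f := (e : ZMod q)) (g := k) (fun h0 => ?_) (by
      linear_combination -e1 + (4 * k + l) * hx)
    exact e3.elim (· (by simpa [h0, hx] using e1)) (· hx)
  obtain ⟨⟨e1, e2⟩, e3⟩ := E p inferInstance
  obtain ⟨t2, t3⟩ := zmod_two_three_ne_zero (p := p) hmod
  rw [CharP.cast_eq_zero, zero_mul] at e1
  have sn := isSquare_intCast_of_dvd_six (p := p) hmod (d := -1) (by norm_num)
  have st := isSquare_intCast_of_dvd_six (p := p) hmod (d := 2) (by norm_num)
  push_cast at sn st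
  refine hr (exists_root_of_sq_eq_three_mul_sq (x := (-(k + 2 * l) : ZMod p)) (y := l) ?_ ?_
    ?_ s2)
  · intro h0
    exact e3.elim (· (by simpa [h0] using e1)) (· h0)
  · linear_combination e1
  · have hf : ((f : ZMod p) - 2 * (k + l)) * (f + 2 * (k + l)) = 0 := by
      linear_combination -e2 - 3 * e1
    rcases mul_eq_zero.mp hf with h | h
    · have : (-(k + 2 * l) + l : ZMod p) = -1 * (f / 2) := by
        field_simp; linear_combination h
      rw [this]
      exact sn.mul (s1.div st)
    · have : (-(k + 2 * l) + l : ZMod p) = f / 2 := by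
        field_simp; linear_combination -h
      rw [this]
      exact s1.div st

theorem zmod_ne_zero_of_forall_prime {a e : ℤ}
    (hc : ∀ q : ℤ, Prime q → ¬ q ∣ 6 → q ∣ a → q ∣ e → False) (q : ℕ) [Fact q.Prime]
    (h2 : (2 : ZMod q) ≠ 0) (h3 : (3 : ZMod q) ≠ 0) (ha : (a : ZMod q) = 0)
    (he : (e : ZMod q) = 0) : False := by
  rw [ZMod.intCast_zmod_eq_zero_iff_dvd] at ha he
  refine hc q (Nat.prime_iff_prime_int.mp Fact.out) (fun h6 => ?_) ha he
  rw [← ZMod.intCast_zmod_eq_zero_iff_dvd] at h6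
  push_cast at h6
  exact mul_ne_zero h2 h3 (by linear_combination h6)

theorem dvd_of_dvd_of_dvd_of_eq {P a b e q α β : ℤ} (hP : Squarefree P) (ha : q ∣ a) (hb : q ∣ b)
    (h : α * b ^ 2 + β * a ^ 2 = P * e ^ 2) : q ∣ e := by
  refine dvd_of_sq_dvd_mul_sq hP ?_
  rw [← h]
  exact dvd_add (Dvd.dvd.mul_left (pow_dvd_pow_of_dvd hb 2) _)
    (Dvd.dvd.mul_left (pow_dvd_pow_of_dvd ha 2) _)

theorem squarefree_natCast_prime (p : ℕ) [Fact p.Prime] : Squarefree (p : ℤ) :=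
  (Nat.prime_iff_prime_int.mp Fact.out).squarefree

theorem zmod_zero_of_zero_of_zero {p : ℕ} [Fact p.Prime] {a b e α β : ℤ}
    (ha : (a : ZMod p) = 0) (hb : (b : ZMod p) = 0)
    (h : α * b ^ 2 + β * a ^ 2 = p * e ^ 2) : (e : ZMod p) = 0 := by
  rw [ZMod.intCast_zmod_eq_zero_iff_dvd] at ha hb ⊢
  exact dvd_of_dvd_of_dvd_of_eq (squarefree_natCast_prime p) ha hb h

theorem obstruction_neg_two_one {p : ℕ} [Fact p.Prime] (hmod : p % 24 = 1)
    (hr : ¬∃ w : ZMod p, w ^ 4 - 2 * w ^ 2 - 2 = 0) {a b c e : ℤ}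
    (hc : ∀ q : ℤ, Prime q → ¬ q ∣ 6 → q ∣ a → q ∣ e → False)
    (h1 : b ^ 2 + 2 * a ^ 2 = p * e ^ 2) (h2 : c ^ 2 = a ^ 2 + p * e ^ 2) : False := by
  have E : ∀ q : ℕ, Fact q.Prime → ((b : ZMod q) ^ 2 + 2 * a ^ 2 = p * e ^ 2 ∧
      (c : ZMod q) ^ 2 = a ^ 2 + p * e ^ 2) :=
    fun q _ => ⟨by exact_mod_cast congrArg (Int.cast : ℤ → ZMod q) h1,
      by exact_mod_cast congrArg (Int.cast : ℤ → ZMod q) h2⟩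
  have s1 : IsSquare ((c + b : ℤ) : ZMod p) := by
    refine isSquare_intCast_of_forall_prime hmod fun q _ h2 h3 hx => ?_
    push_cast at hx
    obtain ⟨e1, e2⟩ := E q inferInstance
    refine isSquare_of_mul_sq_eq (f := 3 * (e : ZMod q)) (g := 3 * b) (fun h0 => ?_) (by
      linear_combination -9 * e1 + 6 * (e1 - e2 + (c - b) * hx))
    exact zmod_ne_zero_of_forall_prime hc q h2 h3
      (eq_zero_of_two_three_mul h2 h3 (by clear * - e1 e2 hx; grind)) (by simpa [h3] using h0)
  have s2 : IsSquare ((a : ℤ) : ZMod p) := by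
    refine isSquare_intCast_of_forall_prime hmod fun q _ h2 h3 hx => ?_
    obtain ⟨e1, e2⟩ := E q inferInstance
    exact isSquare_of_mul_sq_eq (f := (e : ZMod q)) (g := b)
      (zmod_ne_zero_of_forall_prime hc q h2 h3 hx) (by linear_combination -e1 + 2 * a * hx)
  obtain ⟨e1, e2⟩ := E p inferInstance
  obtain ⟨t2, t3⟩ := zmod_two_three_ne_zero (p := p) hmod
  rw [CharP.cast_eq_zero, zero_mul] at e1 e2
  have sn := isSquare_intCast_of_dvd_six (p := p) hmod (d := -1) (by norm_num)
  push_cast at sn s1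
  have ha : (a : ZMod p) ≠ 0 := fun h0 => zmod_ne_zero_of_forall_prime hc p t2 t3 h0
    (zmod_zero_of_zero_of_zero h0 (by simpa [h0] using e1) (α := 1) (β := 2)
      (by linear_combination h1))
  have hf : ((c : ZMod p) - a) * (c + a) = 0 := by linear_combination e2
  rcases mul_eq_zero.mp hf with h | h
  · refine hr (exists_root_of_sq_eq_neg_two_mul_sq hmod (x := (b : ZMod p)) (y := a) ha
      (by linear_combination e1) ?_ s2)
    rwa [show (b : ZMod p) + a = c + b by linear_combination -h]
  · refine hr (exists_root_of_sq_eq_neg_two_mul_sq hmod (x := (b : ZMod p)) (y := -1 * a)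
      (by simpa using ha) (by linear_combination e1) ?_ (sn.mul s2))
    rwa [show (b : ZMod p) + -1 * a = c + b by linear_combination -h]

theorem obstruction_neg_one_three {p : ℕ} [Fact p.Prime] (hmod : p % 24 = 1)
    (hr : ¬∃ w : ZMod p, w ^ 4 - 2 * w ^ 2 - 2 = 0) {a b c e : ℤ}
    (hc : ∀ q : ℤ, Prime q → ¬ q ∣ 6 → q ∣ a → q ∣ e → False)
    (h1 : 3 * b ^ 2 + a ^ 2 = p * e ^ 2) (h2 : c ^ 2 = a ^ 2 + 2 * b ^ 2) : False := by
  have E : ∀ q : ℕ, Fact q.Prime → (3 * (b : ZMod q) ^ 2 + a ^ 2 = p * e ^ 2 ∧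
      (c : ZMod q) ^ 2 = a ^ 2 + 2 * b ^ 2) :=
    fun q _ => ⟨by exact_mod_cast congrArg (Int.cast : ℤ → ZMod q) h1,
      by exact_mod_cast congrArg (Int.cast : ℤ → ZMod q) h2⟩
  have s1 : IsSquare ((a + c : ℤ) : ZMod p) := by
    refine isSquare_intCast_of_forall_prime hmod fun q _ h2 h3 hx => ?_
    push_cast at hx
    obtain ⟨e1, e2⟩ := E q inferInstance
    refine isSquare_of_mul_sq_eq (f := 2 * (e : ZMod q)) (g := 2 * a) (fun h0 => ?_) (by
      linear_combination -4 * e1 - 6 * e2 + 6 * (c - a) * hx)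
    exact zmod_ne_zero_of_forall_prime hc q h2 h3
      (eq_zero_of_two_three_mul h2 h3 (by clear * - h0 e1 e2 hx; grind)) (by simpa [h2] using h0)
  have s2 : IsSquare ((c : ℤ) : ZMod p) := by
    refine isSquare_intCast_of_forall_prime hmod fun q _ h2 h3 hx => ?_
    obtain ⟨e1, e2⟩ := E q inferInstance
    exact isSquare_of_mul_sq_eq (f := (e : ZMod q)) (g := b)
      (fun h0 => zmod_ne_zero_of_forall_prime hc q h2 h3
        (eq_zero_of_two_three_mul h2 h3 (by clear * - h0 e1 e2 hx; grind)) h0)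
      (by linear_combination -e1 - e2 + c * hx)
  obtain ⟨e1, e2⟩ := E p inferInstance
  obtain ⟨t2, t3⟩ := zmod_two_three_ne_zero (p := p) hmod
  rw [CharP.cast_eq_zero, zero_mul] at e1
  push_cast at s1
  refine hr (exists_root_of_sq_eq_three_mul_sq (x := (a : ZMod p)) (y := c) (fun h0 => ?_)
    (by linear_combination -2 * e1 - 3 * e2) s1 s2)
  have ha : (a : ZMod p) = 0 := eq_zero_of_two_three_mul t2 t3 (by clear * - h0 e1 e2; grind)
  have hb : (b : ZMod p) = 0 := eq_zero_of_two_three_mul t2 t3 (by clear * - h0 e1 e2; grind)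
  exact zmod_ne_zero_of_forall_prime hc p t2 t3 ha
    (zmod_zero_of_zero_of_zero ha hb (α := 3) (β := 1) (by linear_combination h1))

theorem obstruction_two_three {p : ℕ} [Fact p.Prime] (hmod : p % 24 = 1)
    (hr : ¬∃ w : ZMod p, w ^ 4 - 2 * w ^ 2 - 2 = 0) {a b c e : ℤ} (hb : b ≠ 0)
    (hc : ∀ q : ℤ, Prime q → ¬ q ∣ 6 → q ∣ a → q ∣ e → False)
    (h1 : 3 * b ^ 2 - 2 * a ^ 2 = p * e ^ 2) (h2 : c ^ 2 = a ^ 2 - b ^ 2) : False := by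
  have E : ∀ q : ℕ, Fact q.Prime → (3 * (b : ZMod q) ^ 2 - 2 * a ^ 2 = p * e ^ 2 ∧
      (c : ZMod q) ^ 2 = a ^ 2 - b ^ 2) :=
    fun q _ => ⟨by exact_mod_cast congrArg (Int.cast : ℤ → ZMod q) h1,
      by exact_mod_cast congrArg (Int.cast : ℤ → ZMod q) h2⟩
  have s1 : IsSquare ((a + c : ℤ) : ZMod p) := by
    have hd : ∀ q : ℤ, Prime q → q ∣ a + c → q ∣ a - c → q ∣ 6 := by
      intro q hq hq1 hq2
      by_contra h6
      have hq2' : ¬ q ∣ 2 := fun h => h6 (h.trans (by norm_num))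
      have ha : q ∣ a := (hq.dvd_or_dvd (by
        have := dvd_add hq1 hq2
        rwa [show a + c + (a - c) = 2 * a by ring] at this)).resolve_left hq2'
      have hb : q ∣ b := hq.dvd_of_dvd_pow (n := 2) (by
        rw [show b ^ 2 = (a + c) * (a - c) by linear_combination h2]
        exact Dvd.dvd.mul_right hq1 _)
      exact hc q hq h6 ha (dvd_of_dvd_of_dvd_of_eq (squarefree_natCast_prime p) ha hb
        (α := 3) (β := -2) (by linear_combination h1))
    obtain ⟨d, m, z, h, hd6, hm⟩ := exists_eq_mul_sq_of_mul_eq (x := a + c) (y := a - c) (w := b)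
      Admissible.one (dvd_refl 6) (by linear_combination -h2) hb hd
    have hm1 : m = 1 := by simpa using hm
    rw [h, hm1]
    push_cast
    rw [mul_one]
    exact (isSquare_intCast_of_dvd_six hmod hd6).mul (IsSquare.sq _)
  have s2 : IsSquare ((c : ℤ) : ZMod p) := by
    refine isSquare_intCast_of_forall_prime hmod fun q _ h2 h3 hx => ?_
    obtain ⟨e1, e2⟩ := E q inferInstance
    exact isSquare_of_mul_sq_eq (f := (e : ZMod q)) (g := a)
      (fun h0 => zmod_ne_zero_of_forall_prime hc q h2 h3
        (eq_zero_of_two_three_mul h2 h3 (by clear * - h0 e1 e2 hx; grind)) h0)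
      (by linear_combination -e1 + 3 * e2 - 3 * c * hx)
  obtain ⟨e1, e2⟩ := E p inferInstance
  obtain ⟨t2, t3⟩ := zmod_two_three_ne_zero (p := p) hmod
  rw [CharP.cast_eq_zero, zero_mul] at e1
  push_cast at s1
  refine hr (exists_root_of_sq_eq_three_mul_sq (x := (a : ZMod p)) (y := c) (fun h0 => ?_)
    (by linear_combination e1 - 3 * e2) s1 s2)
  have ha : (a : ZMod p) = 0 := eq_zero_of_two_three_mul t2 t3 (by clear * - h0 e1 e2; grind)
  have hb : (b : ZMod p) = 0 := eq_zero_of_two_three_mul t2 t3 (by clear * - h0 e1 e2; grind)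
  exact zmod_ne_zero_of_forall_prime hc p t2 t3 ha
    (zmod_zero_of_zero_of_zero ha hb (α := 3) (β := -2) (by linear_combination h1))

theorem sq_emod_eight (x : ℤ) :
    (x % 2 = 0 ∧ (x ^ 2 % 8 = 0 ∨ x ^ 2 % 8 = 4)) ∨ (x % 2 = 1 ∧ x ^ 2 % 8 = 1) := by
  have h : x % 8 = 0 ∨ x % 8 = 1 ∨ x % 8 = 2 ∨ x % 8 = 3 ∨ x % 8 = 4 ∨ x % 8 = 5 ∨ x % 8 = 6 ∨
    x % 8 = 7 := by omega
  rcases h with h | h | h | h | h | h | h | h <;> simp [pow_two, Int.mul_emod, h] <;> omega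

theorem mul_sq_emod_eight {m : ℤ} (hm : m % 24 = 1) (x : ℤ) :
    (x % 2 = 0 ∧ (m * x ^ 2 % 8 = 0 ∨ m * x ^ 2 % 8 = 4)) ∨
      (x % 2 = 1 ∧ m * x ^ 2 % 8 = 1) := by
  have h : m * x ^ 2 % 8 = x ^ 2 % 8 := by
    rw [Int.mul_emod, show m % 8 = 1 by omega]; simp
  rw [h]; exact sq_emod_eight x

theorem IsCoprime.emod_two {x y : ℤ} (h : IsCoprime x y) : x % 2 = 1 ∨ y % 2 = 1 := by
  obtain ⟨u, v, huv⟩ := h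
  by_contra! hcon
  obtain ⟨k, hk⟩ : (2 : ℤ) ∣ x := by omega
  obtain ⟨l, hl⟩ : (2 : ℤ) ∣ y := by omega
  subst hk hl
  have : 2 * (u * k + v * l) = 1 := by linarith
  omega

/-- Two coprime nonnegative factors of `p` times a square. -/
theorem exists_of_coprime_of_mul_eq_prime_mul_sq {U V k q : ℤ} (hq : Prime q) (hq0 : 0 < q)
    (hU : 0 ≤ U) (hV : 0 ≤ V) (hc : IsCoprime U V) (h : U * V = q * k ^ 2) :
    ∃ u v : ℤ, (U = q * u ^ 2 ∧ V = v ^ 2) ∨ (U = u ^ 2 ∧ V = q * v ^ 2) := by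
  obtain ⟨s, u, v, hs, huv⟩ := exists_sq_of_coprime_of_mul_eq_prime_mul_sq hq hc h
  have hu := sq_nonneg u
  have hv := sq_nonneg v
  have hqu : 0 ≤ q * u ^ 2 := by positivity
  have hqv : 0 ≤ q * v ^ 2 := by positivity
  rcases hs with rfl | rfl
  · exact ⟨u, v, by simpa using huv⟩
  · exfalso
    have hUV : U = 0 ∧ V = 0 := by
      rcases huv with ⟨h1, h2⟩ | ⟨h1, h2⟩ <;> constructor <;> linarith
    rw [hUV.1, hUV.2] at hc
    exact not_isCoprime_zero_zero hc

theorem prime_dvd_of_dvd_two_mul_sq {q x : ℤ} (hq : Prime q) (h2 : ¬ q ∣ 2) {c : ℤ}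
    (hc : c ∣ 2 ^ 6) (h : q ∣ c * x ^ 2) : q ∣ x := by
  rcases hq.dvd_or_dvd h with h | h
  · exact absurd (hq.dvd_of_dvd_pow (h.trans hc)) h2
  · exact hq.dvd_of_dvd_pow h

theorem not_dvd_two_of_dvd_odd {q x : ℤ} (hq : Prime q) (hx : x % 2 = 1) (h : q ∣ x) :
    ¬ q ∣ 2 := by
  intro h2
  apply hq.not_isUnit
  apply isUnit_of_dvd_one
  rw [show (1 : ℤ) = x - 2 * (x / 2) by omega]
  exact dvd_sub h (Dvd.dvd.mul_right h2 _)

theorem IsCoprime.false_of_prime {x y q : ℤ} (h : IsCoprime x y) (hq : Prime q) (hx : q ∣ x)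
    (hy : q ∣ y) : False := hq.not_isUnit (h.isUnit_of_dvd' hx hy)

theorem dvd_of_eq_add {q a b c u v : ℤ} (ha : q ∣ a) (hb : q ∣ b) (h : c = u * a + v * b) :
    q ∣ c := h ▸ dvd_add (Dvd.dvd.mul_left ha _) (Dvd.dvd.mul_left hb _)

theorem obstruction_neg_one {p : ℕ} [Fact p.Prime] (hmod : p % 24 = 1)
    (hr : ¬∃ w : ZMod p, w ^ 4 - 2 * w ^ 2 - 2 = 0) {M e a b : ℤ} (hc : IsCoprime M e)
    (h1 : M ^ 2 + a ^ 2 = p * e ^ 2) (h2 : M ^ 2 + b ^ 2 = 4 * (p * e ^ 2)) : False := by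
  have hp : Prime (p : ℤ) := Nat.prime_iff_prime_int.mp Fact.out
  have hp0 : (0 : ℤ) < p := by exact_mod_cast (Fact.out (p := p.Prime)).pos
  have hm : (p : ℤ) % 24 = 1 := by omega
  have r1 := sq_emod_eight M
  have r2 := sq_emod_eight a
  have r3 := sq_emod_eight b
  have r4 := mul_sq_emod_eight hm e
  have r5 := hc.emod_two
  obtain ⟨m, rfl⟩ : (2 : ℤ) ∣ M := by omega
  obtain ⟨c, rfl⟩ : (2 : ℤ) ∣ b := by omega
  have h3 : m ^ 2 + c ^ 2 = p * e ^ 2 := by linarith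
  have r6 := sq_emod_eight m
  have r7 := sq_emod_eight c
  have r8 : (2 * m) ^ 2 = 4 * m ^ 2 := by ring
  obtain ⟨k, rfl⟩ : (2 : ℤ) ∣ m := by omega
  have hcodd : c % 2 = 1 := by omega
  have haodd : a % 2 = 1 := by omega
  obtain ⟨U, hU⟩ : (2 : ℤ) ∣ c - a := by omega
  obtain ⟨V, hV⟩ : (2 : ℤ) ∣ c + a := by omega
  have hUV : U * V = 3 * k ^ 2 := by
    have : 4 * (U * V) = 4 * (3 * k ^ 2) := by
      rw [show 4 * (U * V) = (2 * U) * (2 * V) by ring, ← hU, ← hV]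
      linear_combination h3 - h1
    linarith
  have hco : IsCoprime U V := by
    refine IsCoprime.of_forall_prime (by omega) fun q hq hqU hqV => ?_
    have hqc : q ∣ c := dvd_of_eq_add hqU hqV (u := 1) (v := 1) (by linarith)
    have hqa : q ∣ a := dvd_of_eq_add hqU hqV (u := -1) (v := 1) (by linarith)
    have hq2 := not_dvd_two_of_dvd_odd hq haodd hqa
    have hqm : q ∣ 2 * (2 * k) := by
      have : q ^ 2 ∣ 3 * (2 * (2 * k)) ^ 2 := by
        have h5 := dvd_sub (pow_dvd_pow_of_dvd hqc 2) (pow_dvd_pow_of_dvd hqa 2)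
        rw [show 3 * (2 * (2 * k)) ^ 2 = 4 * (c ^ 2 - a ^ 2) by linear_combination 4 * h1 - 4 * h3]
        exact Dvd.dvd.mul_left h5 _
      exact dvd_of_sq_dvd_mul_sq (squarefree_of_dvd_six (by norm_num)) this
    exact hc.false_of_prime hq hqm (dvd_of_dvd_of_dvd_of_eq (α := 1) (β := 1) hp.squarefree hqm hqa
      (by linear_combination h1))
  have key : ∀ u v : ℤ, IsCoprime u v → (u ^ 2 + v ^ 2) * (u ^ 2 + 9 * v ^ 2) = p * e ^ 2 →
      False := by
    intro u v huv h5
    have hco' : IsCoprime (u ^ 2 + v ^ 2) (u ^ 2 + 9 * v ^ 2) := by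
      refine IsCoprime.of_forall_prime ?_ fun q hq hq1 hq2 => ?_
      · by_contra! h0
        rw [h0.1] at h5
        omega
      have hodd : (u ^ 2 + v ^ 2) % 2 = 1 := by
        by_contra h6
        obtain ⟨j, hj⟩ : (2 : ℤ) ∣ u ^ 2 + v ^ 2 := by omega
        rw [hj, mul_assoc] at h5
        omega
      have hqq := not_dvd_two_of_dvd_odd hq hodd hq1
      exact huv.false_of_prime hq
        (prime_dvd_of_dvd_two_mul_sq hq hqq (c := 8) (by norm_num)
          (dvd_of_eq_add hq1 hq2 (u := 9) (v := -1) (by ring)))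
        (prime_dvd_of_dvd_two_mul_sq hq hqq (c := 8) (by norm_num)
          (dvd_of_eq_add hq1 hq2 (u := -1) (v := 1) (by ring)))
    obtain ⟨f, g, h | h⟩ := exists_of_coprime_of_mul_eq_prime_mul_sq hp hp0 (by positivity)
      (by positivity) hco' h5
    · exact obstruction_aux₁ hmod hr huv h.1 h.2
    · exact obstruction_aux₂ hmod hr huv h.1 h.2
  obtain ⟨s, u, v, hs, h⟩ := exists_sq_of_coprime_of_mul_eq_prime_mul_sq
    Int.prime_three hco hUV
  have hs2 : s ^ 2 = 1 := by rcases hs with rfl | rfl <;> norm_num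
  have hcc : c = U + V := by linarith
  have hdvd : u ∣ U ∧ v ∣ V := by
    rcases h with h | h <;> rw [h.1, h.2]
    exacts [⟨⟨s * (3 * u), by ring⟩, ⟨s * v, by ring⟩⟩, ⟨⟨s * u, by ring⟩, ⟨s * (3 * v), by ring⟩⟩]
  have huv : IsCoprime u v :=
    (hco.of_isCoprime_of_dvd_left hdvd.1).of_isCoprime_of_dvd_right hdvd.2
  have hk : 3 * k ^ 2 = 3 * (u * v) ^ 2 := by
    rw [← hUV]
    rcases h with h | h <;> rw [h.1, h.2] <;> linear_combination 3 * (u * v) ^ 2 * hs2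
  have hk' : (2 * k) ^ 2 = 4 * (u * v) ^ 2 := by linarith
  rcases h with h | h
  · refine key v u huv.symm ?_
    rw [← h3, hk', hcc, h.1, h.2]
    linear_combination (-(3 * u ^ 2 + v ^ 2) ^ 2) * hs2
  · refine key u v huv ?_
    rw [← h3, hk', hcc, h.1, h.2]
    linear_combination (-(u ^ 2 + 3 * v ^ 2) ^ 2) * hs2

theorem obstruction_neg_three {p : ℕ} [Fact p.Prime] (hmod : p % 24 = 1)
    (hr : ¬∃ w : ZMod p, w ^ 4 - 2 * w ^ 2 - 2 = 0) {M e a b : ℤ} (hc : IsCoprime M e)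
    (h1 : M ^ 2 + 3 * a ^ 2 = p * e ^ 2) (h2 : M ^ 2 + 3 * b ^ 2 = 4 * (p * e ^ 2)) : False := by
  have hp : Prime (p : ℤ) := Nat.prime_iff_prime_int.mp Fact.out
  have hp0 : (0 : ℤ) < p := by exact_mod_cast (Fact.out (p := p.Prime)).pos
  have hm : (p : ℤ) % 24 = 1 := by omega
  have r1 := sq_emod_eight M
  have r2 := sq_emod_eight a
  have r3 := sq_emod_eight b
  have r4 := mul_sq_emod_eight hm e
  have r5 := hc.emod_two
  have hM : M % 2 = 1 := by omega
  have hb : b % 2 = 1 := by omega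
  have he : p * e ^ 2 % 2 = 1 := by omega
  obtain ⟨U, hU⟩ : (2 : ℤ) ∣ b + M := by omega
  obtain ⟨V, hV⟩ : (2 : ℤ) ∣ b - M := by omega
  have h3 : b ^ 2 = M ^ 2 + 4 * a ^ 2 := by linarith
  have hUV : U * V = a ^ 2 := by
    have : 4 * (U * V) = 4 * a ^ 2 := by
      rw [show 4 * (U * V) = (2 * U) * (2 * V) by ring, ← hU, ← hV]
      linear_combination h3
    linarith
  have hco : IsCoprime U V := by
    refine IsCoprime.of_forall_prime (by omega) fun q hq hqU hqV => ?_
    have hqM : q ∣ M := dvd_of_eq_add hqU hqV (u := 1) (v := -1) (by linarith)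
    have hqa : q ∣ a := hq.dvd_of_dvd_pow (n := 2) (hUV ▸ Dvd.dvd.mul_right hqU _)
    exact hc.false_of_prime hq hqM (dvd_of_dvd_of_dvd_of_eq (α := 1) (β := 3) hp.squarefree hqa hqM
      (by linear_combination h1))
  have key : ∀ k l : ℤ, IsCoprime k l →
      (k ^ 2 + k * l + l ^ 2) * (k ^ 2 - k * l + l ^ 2) = p * e ^ 2 → False := by
    intro k l hkl h5
    have hco' : IsCoprime (k ^ 2 + k * l + l ^ 2) (k ^ 2 - k * l + l ^ 2) := by
      refine IsCoprime.of_forall_prime ?_ fun q hq hq1 hq2 => ?_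
      · by_contra! h0
        rw [h0.1] at h5
        omega
      have hqq := not_dvd_two_of_dvd_odd hq he (h5 ▸ Dvd.dvd.mul_right hq1 _)
      have hq3 : q ∣ 2 * (k * l) := dvd_of_eq_add hq1 hq2 (u := 1) (v := -1) (by ring)
      have hq4 : q ∣ k * l := (hq.dvd_or_dvd hq3).resolve_left hqq
      have hq5 : q ∣ k ^ 2 + l ^ 2 := dvd_of_eq_add hq1 hq4 (u := 1) (v := -1) (by ring)
      rcases hq.dvd_or_dvd hq4 with h | h
      · exact hkl.false_of_prime hq h (hq.dvd_of_dvd_pow (n := 2)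
          (dvd_of_eq_add hq5 h (u := 1) (v := -k) (by ring)))
      · exact hkl.false_of_prime hq (hq.dvd_of_dvd_pow (n := 2)
          (dvd_of_eq_add hq5 h (u := 1) (v := -l) (by ring))) h
    obtain ⟨f, g, h | h⟩ := exists_of_coprime_of_mul_eq_prime_mul_sq hp hp0
      (by nlinarith [sq_nonneg (k + l), sq_nonneg k, sq_nonneg l])
      (by nlinarith [sq_nonneg (k - l), sq_nonneg k, sq_nonneg l]) hco' h5
    · exact obstruction_aux₃ hmod hr hkl h.1 h.2
    · exact obstruction_aux₃ hmod hr (k := k) (l := -l) (e := g) (f := f) hkl.neg_right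
        (by linear_combination h.2) (by linear_combination h.1)
  obtain ⟨s, u, v, hs, h, h'⟩ := exists_sq_of_coprime_of_mul_eq_sq hco hUV
  have hs2 : s ^ 2 = 1 := by rcases hs with rfl | rfl <;> norm_num
  have hMM : M = U - V := by linarith
  have huv : IsCoprime u v :=
    (hco.of_isCoprime_of_dvd_left (h ▸ ⟨s * u, by ring⟩)).of_isCoprime_of_dvd_right
      (h' ▸ ⟨s * v, by ring⟩)
  refine key u v huv ?_
  rw [← h1, ← hUV, hMM, h, h']
  linear_combination (-(u ^ 2 - v ^ 2) ^ 2 - 3 * u ^ 2 * v ^ 2) * hs2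

theorem obstruction_three {p : ℕ} [Fact p.Prime] (hmod : p % 24 = 1)
    (hr : ¬∃ w : ZMod p, w ^ 4 - 2 * w ^ 2 - 2 = 0) {M e a b : ℤ} (hc : IsCoprime M e)
    (h1 : M ^ 2 - 3 * a ^ 2 = p * e ^ 2) (h2 : M ^ 2 - 3 * b ^ 2 = 4 * (p * e ^ 2)) : False := by
  have hp : Prime (p : ℤ) := Nat.prime_iff_prime_int.mp Fact.out
  have hp0 : (0 : ℤ) < p := by exact_mod_cast (Fact.out (p := p.Prime)).pos
  have hm : (p : ℤ) % 24 = 1 := by omega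
  have r1 := sq_emod_eight M
  have r2 := sq_emod_eight a
  have r3 := sq_emod_eight b
  have r4 := mul_sq_emod_eight hm e
  have r5 := hc.emod_two
  obtain ⟨m, rfl⟩ : (2 : ℤ) ∣ M := by omega
  obtain ⟨c, rfl⟩ : (2 : ℤ) ∣ b := by omega
  have h3 : m ^ 2 + c ^ 2 = a ^ 2 := by linarith
  have r6 := sq_emod_eight m
  have r7 := sq_emod_eight c
  have r8 : (2 * m) ^ 2 = 4 * m ^ 2 := by ring
  have r9 : (2 * c) ^ 2 = 4 * c ^ 2 := by ring
  obtain ⟨d, rfl⟩ : (2 : ℤ) ∣ c := by omega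
  have ha : a % 2 = 1 := by omega
  have hmo : m % 2 = 1 := by omega
  have he : p * e ^ 2 % 2 = 1 := by omega
  obtain ⟨U, hU⟩ : (2 : ℤ) ∣ a + m := by omega
  obtain ⟨V, hV⟩ : (2 : ℤ) ∣ a - m := by omega
  have hUV : U * V = d ^ 2 := by
    have : 4 * (U * V) = 4 * d ^ 2 := by
      rw [show 4 * (U * V) = (2 * U) * (2 * V) by ring, ← hU, ← hV]
      linear_combination -h3
    linarith
  have hco : IsCoprime U V := by
    refine IsCoprime.of_forall_prime (by omega) fun q hq hqU hqV => ?_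
    have hqm : q ∣ m := dvd_of_eq_add hqU hqV (u := 1) (v := -1) (by linarith)
    have hqa : q ∣ a := dvd_of_eq_add hqU hqV (u := 1) (v := 1) (by linarith)
    have hqM : q ∣ 2 * m := Dvd.dvd.mul_left hqm _
    exact hc.false_of_prime hq hqM (dvd_of_dvd_of_dvd_of_eq (α := 1) (β := -3) hp.squarefree hqa
      hqM (by linear_combination h1))
  have key : ∀ k l : ℤ, IsCoprime k l →
      (k ^ 2 + 4 * k * l + l ^ 2) * (k ^ 2 - 4 * k * l + l ^ 2) = p * e ^ 2 → False := by
    intro k l hkl h5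
    have hco' : IsCoprime (k ^ 2 + 4 * k * l + l ^ 2) (k ^ 2 - 4 * k * l + l ^ 2) := by
      refine IsCoprime.of_forall_prime ?_ fun q hq hq1 hq2 => ?_
      · by_contra! h0
        rw [h0.1] at h5
        omega
      have hqq := not_dvd_two_of_dvd_odd hq he (h5 ▸ Dvd.dvd.mul_right hq1 _)
      have hq3 : q ∣ 2 * (2 * (2 * (k * l))) :=
        dvd_of_eq_add hq1 hq2 (u := 1) (v := -1) (by ring)
      have hq4 : q ∣ k * l := (hq.dvd_or_dvd ((hq.dvd_or_dvd ((hq.dvd_or_dvd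
        hq3).resolve_left hqq)).resolve_left hqq)).resolve_left hqq
      have hq5 : q ∣ k ^ 2 + l ^ 2 := dvd_of_eq_add hq1 hq4 (u := 1) (v := -4) (by ring)
      rcases hq.dvd_or_dvd hq4 with h | h
      · exact hkl.false_of_prime hq h (hq.dvd_of_dvd_pow (n := 2)
          (dvd_of_eq_add hq5 h (u := 1) (v := -k) (by ring)))
      · exact hkl.false_of_prime hq (hq.dvd_of_dvd_pow (n := 2)
          (dvd_of_eq_add hq5 h (u := 1) (v := -l) (by ring))) h
    have hpos : 0 < (k ^ 2 + 4 * k * l + l ^ 2) * (k ^ 2 - 4 * k * l + l ^ 2) := by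
      rw [h5]
      have : 0 ≤ p * e ^ 2 := by positivity
      omega
    have hsum : 0 ≤ (k ^ 2 + 4 * k * l + l ^ 2) + (k ^ 2 - 4 * k * l + l ^ 2) := by
      nlinarith [sq_nonneg k, sq_nonneg l]
    have hpp : 0 ≤ k ^ 2 + 4 * k * l + l ^ 2 ∧ 0 ≤ k ^ 2 - 4 * k * l + l ^ 2 := by
      rcases pos_and_pos_or_neg_and_neg_of_mul_pos hpos with h | h
      · exact ⟨h.1.le, h.2.le⟩
      · linarith [h.1, h.2]
    obtain ⟨f, g, h | h⟩ := exists_of_coprime_of_mul_eq_prime_mul_sq hp hp0 hpp.1 hpp.2 hco' h5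
    · exact obstruction_aux₄ hmod hr hkl h.1 h.2
    · exact obstruction_aux₄ hmod hr (k := k) (l := -l) (e := g) (f := f) hkl.neg_right
        (by linear_combination h.2) (by linear_combination h.1)
  obtain ⟨s, u, v, hs, h, h'⟩ := exists_sq_of_coprime_of_mul_eq_sq hco hUV
  have hs2 : s ^ 2 = 1 := by rcases hs with rfl | rfl <;> norm_num
  have hMM : a = U + V := by linarith
  have huv : IsCoprime u v :=
    (hco.of_isCoprime_of_dvd_left (h ▸ ⟨s * u, by ring⟩)).of_isCoprime_of_dvd_right
      (h' ▸ ⟨s * v, by ring⟩)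
  refine key u v huv ?_
  have h6 : p * e ^ 2 = a ^ 2 - 16 * d ^ 2 := by linarith
  rw [h6, ← hUV, hMM, h, h']
  linear_combination (-(u ^ 2 + v ^ 2) ^ 2 + 16 * u ^ 2 * v ^ 2) * hs2

/-- The homogeneous space `M² - n e² = g a²`, `M² - 4 n e² = g b²`; for `g = 1` a point is also
required to lie over the point `(r : s : w)` up to sign. -/
def FourCover (n r s w g : ℤ) : Prop :=
  ∃ M e a b : ℤ, M ≠ 0 ∧ e ≠ 0 ∧ a ≠ 0 ∧ b ≠ 0 ∧ M ^ 2 - n * e ^ 2 = g * a ^ 2 ∧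
    M ^ 2 - 4 * (n * e ^ 2) = g * b ^ 2 ∧
    (g = 1 → (M ^ 4 - 4 * n ^ 2 * e ^ 4) * w = (r ^ 2 - 4 * s ^ 2) * (M * a * b * e) ∨
      (M ^ 4 - 4 * n ^ 2 * e ^ 4) * w = -((r ^ 2 - 4 * s ^ 2) * (M * a * b * e)))

theorem FourCover.of_second {n r s w g x t z y : ℤ} (hx : x ≠ 0) (ht : t ≠ 0) (hz : z ≠ 0)
    (hy : y ≠ 0) (h1 : r = x ^ 2) (h2 : s = n * t ^ 2) (h3 : r - s = g * z ^ 2)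
    (h4 : r - 4 * s = g * y ^ 2) (hw : w = g * (x * t * z * y) ∨ w = -(g * (x * t * z * y))) :
    FourCover n r s w g := by
  refine ⟨x, t, z, y, hx, ht, hz, hy, by rw [← h1, ← h2, h3], by rw [← h1, ← h2, h4], ?_⟩
  rintro rfl
  rcases hw with rfl | rfl
  · left; rw [h1, h2]; ring
  · right; rw [h1, h2]; ring

theorem FourCover.of_first {n r s w g x t z y : ℤ} (hx : x ≠ 0) (ht : t ≠ 0) (hz : z ≠ 0)
    (hy : y ≠ 0) (h1 : r = n * x ^ 2) (h2 : s = t ^ 2) (h3 : r - s = g * z ^ 2)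
    (h4 : r - 4 * s = g * y ^ 2) (hw : w = g * (x * t * z * y) ∨ w = -(g * (x * t * z * y))) :
    FourCover n r s w (-g) := by
  refine ⟨2 * t, x, y, 2 * z, by positivity, hx, hy, by positivity, ?_, ?_, ?_⟩
  · linear_combination h1 - 4 * h2 - h4
  · linear_combination 4 * h1 - 4 * h2 - 4 * h3
  intro hg
  obtain rfl : g = -1 := by omega
  rcases hw with rfl | rfl
  · left; rw [h1, h2]; ring
  · right; rw [h1, h2]; ring

theorem FourCover.of_third {n r s w g g' x t z y : ℤ} (hg : g * g' = -3) (hx : x ≠ 0) (ht : t ≠ 0)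
    (hz : z ≠ 0) (hy : y ≠ 0) (h1 : r = x ^ 2) (h2 : s = t ^ 2) (h3 : r - s = g * (n * z ^ 2))
    (h4 : r - 4 * s = g * y ^ 2) (hw : w = g * (x * t * z * y) ∨ w = -(g * (x * t * z * y))) :
    FourCover n r s w g' := by
  have hg0 : g ≠ 0 := by rintro rfl; omega
  have e1 : y ^ 2 - n * z ^ 2 = g' * t ^ 2 := by
    apply mul_left_cancel₀ hg0
    linear_combination h3 - h4 - t ^ 2 * hg - 3 * h2
  have e2 : y ^ 2 - 4 * (n * z ^ 2) = g' * x ^ 2 := by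
    apply mul_left_cancel₀ hg0
    linear_combination 4 * h3 - h4 - x ^ 2 * hg - 3 * h1
  refine ⟨y, z, t, x, hy, hz, ht, hx, e1, e2, ?_⟩
  rintro rfl
  obtain rfl : g = -3 := by omega
  have e3 : 3 * (y ^ 4 - 4 * n ^ 2 * z ^ 4) = 4 * t ^ 4 - x ^ 4 := by
    linear_combination 4 * (y ^ 2 - n * z ^ 2 + t ^ 2) * e1 - (y ^ 2 - 4 * (n * z ^ 2) + x ^ 2) * e2
  rcases hw with rfl | rfl
  · left; rw [h1, h2]; linear_combination (-(x * t * z * y)) * e3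
  · right; rw [h1, h2]; linear_combination (x * t * z * y) * e3

theorem FourCover.of_fourth {n r s w g g' x t z y : ℤ} (hg : g * g' = 3) (hx : x ≠ 0) (ht : t ≠ 0)
    (hz : z ≠ 0) (hy : y ≠ 0) (h1 : r = x ^ 2) (h2 : s = t ^ 2) (h3 : r - s = g * z ^ 2)
    (h4 : r - 4 * s = g * (n * y ^ 2))
    (hw : w = g * (x * t * z * y) ∨ w = -(g * (x * t * z * y))) : FourCover n r s w g' := by
  have hg0 : g ≠ 0 := by rintro rfl; omega
  have e1 : (2 * z) ^ 2 - n * y ^ 2 = g' * x ^ 2 := by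
    apply mul_left_cancel₀ hg0
    linear_combination h4 - 4 * h3 - x ^ 2 * hg + 3 * h1
  have e2 : (2 * z) ^ 2 - 4 * (n * y ^ 2) = g' * (2 * t) ^ 2 := by
    apply mul_left_cancel₀ hg0
    linear_combination 4 * h4 - 4 * h3 - 4 * t ^ 2 * hg + 12 * h2
  refine ⟨2 * z, y, x, 2 * t, by positivity, hy, hx, by positivity, e1, e2, ?_⟩
  rintro rfl
  obtain rfl : g = 3 := by omega
  have e3 : 3 * ((2 * z) ^ 4 - 4 * n ^ 2 * y ^ 4) = 4 * (x ^ 4 - 4 * t ^ 4) := by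
    linear_combination 4 * ((2 * z) ^ 2 - n * y ^ 2 + x ^ 2) * e1 -
      ((2 * z) ^ 2 - 4 * (n * y ^ 2) + (2 * t) ^ 2) * e2
  rcases hw with rfl | rfl
  · left; rw [h1, h2]; linear_combination (x * t * z * y) * e3
  · right; rw [h1, h2]; linear_combination (-(x * t * z * y)) * e3

theorem eq_or_eq_neg_of_mul_sq_eq {n w c : ℤ} (hn : n ≠ 0) (h : n * w ^ 2 = n * c ^ 2) :
    w = c ∨ w = -c :=
  sq_eq_sq_iff_eq_or_eq_neg.mp (mul_left_cancel₀ hn h)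

theorem dvd_six_cases {d D : ℤ} (hD : d ∣ D) (h : D = 1 ∨ D = 2 ∨ D = 3) :
    d = 1 ∨ d = -1 ∨ (D = 2 ∧ (d = 2 ∨ d = -2)) ∨ (D = 3 ∧ (d = 3 ∨ d = -3)) := by
  have h0 : d ≠ 0 := by rintro rfl; rw [zero_dvd_iff] at hD; omega
  have h1 := Int.le_of_dvd (by omega) hD
  have h2 := Int.le_of_dvd (by omega) ((neg_dvd).mpr hD)
  obtain ⟨k, hk⟩ := hD
  have : d = 1 ∨ d = -1 ∨ d = 2 ∨ d = -2 ∨ d = 3 ∨ d = -3 := by omega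
  rcases this with rfl | rfl | rfl | rfl | rfl | rfl <;> omega

theorem two_mul_emod_ne {A B C D g : ℤ} (hg : g = 1 ∨ g = -1 ∨ g = 3 ∨ g = -3)
    (hB : B % 8 = 1) (hA : A % 8 = 0 ∨ A % 8 = 1 ∨ A % 8 = 4)
    (hC : C % 8 = 0 ∨ C % 8 = 1 ∨ C % 8 = 4) (hD : D % 8 = 0 ∨ D % 8 = 1 ∨ D % 8 = 4)
    (h1 : 2 * A - B = g * C) (h2 : A - 2 * B = g * D) : False := by
  rcases hg with rfl | rfl | rfl | rfl <;> omega

/-- Exactly one of `m₁, m₂, m₃, m₄` equals `n`, the others being `1`. -/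
def OneIs (n m₁ m₂ m₃ m₄ : ℤ) : Prop :=
  (m₁ = n ∧ m₂ = 1 ∧ m₃ = 1 ∧ m₄ = 1) ∨ (m₁ = 1 ∧ m₂ = n ∧ m₃ = 1 ∧ m₄ = 1) ∨
    (m₁ = 1 ∧ m₂ = 1 ∧ m₃ = n ∧ m₄ = 1) ∨ (m₁ = 1 ∧ m₂ = 1 ∧ m₃ = 1 ∧ m₄ = n)

theorem exists_fourth_factor {n v D Z w m₁ m₂ m₃ : ℤ} (hn : Admissible n) (hD : D ∣ 6)
    (hZ : Z ≠ 0) (h1 : m₁ = 1 ∨ m₁ = n) (h2 : m₂ = 1 ∨ m₂ = n) (h3 : m₃ = 1 ∨ m₃ = n)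
    (h12 : n ≠ 1 → m₁ = n → m₂ = n → False) (h13 : n ≠ 1 → m₁ = n → m₃ = n → False)
    (h23 : n ≠ 1 → m₂ = n → m₃ = n → False)
    (h : v * D * Z ^ 2 * (m₁ * m₂ * m₃) = n * w ^ 2) :
    ∃ m₄ y : ℤ, v = D * m₄ * y ^ 2 ∧ OneIs n m₁ m₂ m₃ m₄ := by
  have hn0 : n ≠ 0 := hn.1.ne'
  have hone : v * D * Z ^ 2 * n = n * w ^ 2 → ∃ y, v = D * 1 * y ^ 2 := fun h' =>
    exists_eq_of_mul_sq_eq (w := w) Admissible.one hD hZ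
      (mul_left_cancel₀ hn0 (by linear_combination h'))
  rcases h1 with rfl | rfl
  · rcases h2 with rfl | rfl
    · rcases h3 with rfl | rfl
      · obtain ⟨y, hy⟩ := exists_eq_of_mul_sq_eq (v := v) (w := w) hn hD hZ (by linarith)
        exact ⟨n, y, hy, Or.inr (Or.inr (Or.inr ⟨rfl, rfl, rfl, rfl⟩))⟩
      · obtain ⟨y, hy⟩ := hone (by linarith)
        exact ⟨1, y, hy, Or.inr (Or.inr (Or.inl ⟨rfl, rfl, rfl, rfl⟩))⟩
    · have h3' : m₃ = 1 := by
        rcases h3 with h3 | h3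
        · exact h3
        · by_contra h4
          exact h23 (by rwa [← h3]) rfl h3
      subst h3'
      obtain ⟨y, hy⟩ := hone (by linarith)
      exact ⟨1, y, hy, Or.inr (Or.inl ⟨rfl, rfl, rfl, rfl⟩)⟩
  · have h2' : m₂ = 1 := by
      rcases h2 with h3 | h3
      · exact h3
      · by_contra h4
        exact h12 (by rwa [← h3]) rfl h3
    have h3' : m₃ = 1 := by
      rcases h3 with h3 | h3
      · exact h3
      · by_contra h4
        exact h13 (by rwa [← h3]) rfl h3
    subst h2' h3'
    obtain ⟨y, hy⟩ := hone (by linarith)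
    exact ⟨1, y, hy, Or.inl ⟨rfl, rfl, rfl, rfl⟩⟩

theorem exists_factorization_four {n r s w : ℤ} (hn : Admissible n) (hc : IsCoprime r s)
    (hw : w ≠ 0) (hs : 0 < s) (h : r * s * (r - s) * (r - 4 * s) = n * w ^ 2) :
    ∃ d₁ d₃ m₁ m₂ m₃ m₄ x t z y : ℤ, (d₁ = 1 ∨ d₁ = 2) ∧
      (d₃ = 1 ∨ d₃ = -1 ∨ d₃ = 3 ∨ d₃ = -3) ∧ (x ≠ 0 ∧ t ≠ 0 ∧ z ≠ 0 ∧ y ≠ 0) ∧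
      OneIs n m₁ m₂ m₃ m₄ ∧ r = d₁ * (m₁ * x ^ 2) ∧ s = m₂ * t ^ 2 ∧
      r - s = d₃ * (m₃ * z ^ 2) ∧ r - 4 * s = d₁ * (d₃ * (m₄ * y ^ 2)) := by
  have hn0 : 0 < n := hn.1
  have hw2 : 0 < n * w ^ 2 := by positivity
  have hne : r * s * (r - s) * (r - 4 * s) ≠ 0 := by rw [h]; positivity
  have hr : 0 < r := by
    by_contra hr
    have e1 : 0 ≤ (r - s) * (r - 4 * s) := by nlinarith
    have e2 : r * s ≤ 0 := by nlinarith
    nlinarith [mul_nonneg e1 (neg_nonneg.mpr e2)]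
  have hrs : ∀ q : ℤ, Prime q → q ∣ r → q ∣ s → False := fun q hq h1 h2 => hc.false_of_prime hq h1 h2
  obtain ⟨d1, m1, x, h1, hd1, hm1⟩ := exists_eq_mul_sq_of_mul_eq (D := 2) (x := r)
    (y := s * (r - s) * (r - 4 * s)) hn (by norm_num) (by rw [← h]; ring) hw
    (fun q hq hq1 hq2 => by
      rcases hq.dvd_or_dvd hq2 with hq2 | hq2
      · rcases hq.dvd_or_dvd hq2 with hq2 | hq2
        · exact (hrs q hq hq1 hq2).elim
        · exact (hrs q hq hq1 (dvd_of_eq_add hq1 hq2 (u := 1) (v := -1) (by ring))).elim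
      · have : q ∣ 2 * (2 * s) := dvd_of_eq_add hq1 hq2 (u := 1) (v := -1) (by ring)
        rcases hq.dvd_or_dvd this with h | h
        · exact h
        · exact (hq.dvd_or_dvd h).resolve_right (hrs q hq hq1))
  obtain ⟨d2, m2, t, h2, hd2, hm2⟩ := exists_eq_mul_sq_of_mul_eq (D := 1) (x := s)
    (y := r * (r - s) * (r - 4 * s)) hn (by norm_num) (by rw [← h]; ring) hw
    (fun q hq hq1 hq2 => by
      exfalso
      rcases hq.dvd_or_dvd hq2 with hq2 | hq2
      · rcases hq.dvd_or_dvd hq2 with hq2 | hq2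
        · exact hrs q hq hq2 hq1
        · exact hrs q hq (dvd_of_eq_add hq1 hq2 (u := 1) (v := 1) (by ring)) hq1
      · exact hrs q hq (dvd_of_eq_add hq1 hq2 (u := 4) (v := 1) (by ring)) hq1)
  obtain ⟨d3, m3, z, h3, hd3, hm3⟩ := exists_eq_mul_sq_of_mul_eq (D := 3) (x := r - s)
    (y := r * s * (r - 4 * s)) hn (by norm_num) (by rw [← h]; ring) hw
    (fun q hq hq1 hq2 => by
      rcases hq.dvd_or_dvd hq2 with hq2 | hq2
      · exfalso
        rcases hq.dvd_or_dvd hq2 with hq2 | hq2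
        · exact hrs q hq hq2 (dvd_of_eq_add hq1 hq2 (u := -1) (v := 1) (by ring))
        · exact hrs q hq (dvd_of_eq_add hq1 hq2 (u := 1) (v := 1) (by ring)) hq2
      · have : q ∣ 3 * s := dvd_of_eq_add hq1 hq2 (u := 1) (v := -1) (by ring)
        refine (hq.dvd_or_dvd this).resolve_right fun h => ?_
        exact hrs q hq (dvd_of_eq_add hq1 h (u := 1) (v := 1) (by ring)) h)
  have hm10 : 0 < m1 := by rcases hm1 with rfl | rfl <;> omega
  have hm20 : 0 < m2 := by rcases hm2 with rfl | rfl <;> omega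
  obtain rfl : d2 = 1 := by
    rcases dvd_six_cases hd2 (by norm_num) with rfl | rfl | h | h
    · rfl
    · nlinarith [sq_nonneg t]
    · omega
    · omega
  have hx : x ≠ 0 := by rintro rfl; simp at h1; omega
  have ht : t ≠ 0 := by rintro rfl; simp at h2; omega
  have hz : z ≠ 0 := by
    rintro rfl
    apply hne; rw [show r - s = 0 by simpa using h3]; ring
  have hd1' : d1 = 1 ∨ d1 = 2 := by
    have : 0 < d1 := by
      by_contra hd
      have : 0 ≤ m1 * x ^ 2 := by positivity
      nlinarith
    rcases dvd_six_cases hd1 (by norm_num) with h | h | h | h <;> omega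
  have hd3' : d3 = 1 ∨ d3 = -1 ∨ d3 = 3 ∨ d3 = -3 := by
    rcases dvd_six_cases hd3 (by norm_num) with h | h | h | h <;> omega
  have hdd : d1 * d3 ∣ 6 := mul_dvd_mul hd1 hd3
  have a1 : m1 = n → n ∣ r := fun e => by rw [h1, e]; exact ⟨d1 * x ^ 2, by ring⟩
  have a2 : m2 = n → n ∣ s := fun e => by rw [h2, e]; exact ⟨1 * t ^ 2, by ring⟩
  have a3 : m3 = n → n ∣ r - s := fun e => by rw [h3, e]; exact ⟨d3 * z ^ 2, by ring⟩
  obtain ⟨m4, y, h4, hcases⟩ := exists_fourth_factor (v := r - 4 * s) (Z := x * t * z) hn hdd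
    (by positivity) hm1 hm2 hm3
    (fun h0 e1 e2 => hrs n (hn.2.2.resolve_left h0) (a1 e1) (a2 e2))
    (fun h0 e1 e3 => hrs n (hn.2.2.resolve_left h0) (a1 e1) ((dvd_sub_right (a1 e1)).mp (a3 e3)))
    (fun h0 e2 e3 => hrs n (hn.2.2.resolve_left h0) ((dvd_sub_left (a2 e2)).mp (a3 e3)) (a2 e2))
    (show _ = n * w ^ 2 by
      rw [← h]
      linear_combination (-(s * (r - s) * (r - 4 * s))) * h1 -
        (d1 * m1 * x ^ 2 * (r - s) * (r - 4 * s)) * h2 -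
        (d1 * m1 * x ^ 2 * (m2 * t ^ 2) * (r - 4 * s)) * h3)
  have hy : y ≠ 0 := by
    rintro rfl
    apply hne; rw [show r - 4 * s = 0 by simpa using h4]; ring
  exact ⟨d1, d3, m1, m2, m3, m4, x, t, z, y, hd1', hd3', ⟨hx, ht, hz, hy⟩, hcases,
    by linear_combination h1, by linear_combination h2, by linear_combination h3,
    by linear_combination h4⟩

theorem exists_fourCover_of_pos {n r s w : ℤ} (hn : Admissible n) (hc : IsCoprime r s)
    (hw : w ≠ 0) (hs : 0 < s) (h : r * s * (r - s) * (r - 4 * s) = n * w ^ 2) :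
    ∃ g : ℤ, (g = 1 ∨ g = -1 ∨ g = 3 ∨ g = -3) ∧ (n = 1 → g = 1) ∧ FourCover n r s w g := by
  obtain ⟨d₁, g, m₁, m₂, m₃, m₄, x, t, z, y, hd, hg, ⟨hx, ht, hz, hy⟩, hm, h1, h2, h3, h4⟩ :=
    exists_factorization_four hn hc hw hs h
  have hn0 : n ≠ 0 := hn.1.ne'
  have hmod : m₁ % 24 = 1 ∧ m₂ % 24 = 1 ∧ m₃ % 24 = 1 ∧ m₄ % 24 = 1 := by
    have := hn.2.1
    unfold OneIs at hm
    omega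
  have hmm : m₁ * m₂ * m₃ * m₄ = n := by
    rcases hm with ⟨e1, e2, e3, e4⟩ | ⟨e1, e2, e3, e4⟩ | ⟨e1, e2, e3, e4⟩ | ⟨e1, e2, e3, e4⟩ <;>
      rw [e1, e2, e3, e4] <;> ring
  obtain rfl : d₁ = 1 := by
    rcases hd with rfl | rfl
    · rfl
    exfalso
    have A := mul_sq_emod_eight hmod.1 x
    have B := mul_sq_emod_eight hmod.2.1 t
    have C := mul_sq_emod_eight hmod.2.2.1 z
    have D := mul_sq_emod_eight hmod.2.2.2 y
    have E := hc.emod_two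
    refine two_mul_emod_ne (A := m₁ * x ^ 2) (B := m₂ * t ^ 2) (C := m₃ * z ^ 2)
      (D := m₄ * y ^ 2) hg (by omega) (by omega) (by omega) (by omega) ?_ ?_
    · linarith
    · linarith
  have hww : w = g * (x * t * z * y) ∨ w = -(g * (x * t * z * y)) := by
    apply eq_or_eq_neg_of_mul_sq_eq hn0
    rw [← h, h4, h3, h2, h1, ← hmm]
    ring
  rw [one_mul] at h1 h4
  by_cases hn1 : n = 1
  · subst hn1
    obtain ⟨rfl, rfl, rfl, rfl⟩ : m₁ = 1 ∧ m₂ = 1 ∧ m₃ = 1 ∧ m₄ = 1 := by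
      unfold OneIs at hm; omega
    refine ⟨1, Or.inl rfl, fun _ => rfl, ?_⟩
    rcases hg with rfl | rfl | rfl | rfl
    · exact .of_second hx ht hz hy (by linarith) (by linarith) (by linarith) (by linarith) hww
    · exact .of_first (g := -1) hx ht hz hy (by linarith) (by linarith) (by linarith)
        (by linarith) hww
    · exact .of_fourth (g := 3) (by norm_num) hx ht hz hy (by linarith) (by linarith)
        (by linarith) (by linarith) hww
    · exact .of_third (g := -3) (by norm_num) hx ht hz hy (by linarith) (by linarith)
        (by linarith) (by linarith) hww
  rcases hm with ⟨rfl, rfl, rfl, rfl⟩ | ⟨rfl, rfl, rfl, rfl⟩ | ⟨rfl, rfl, rfl, rfl⟩ |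
    ⟨rfl, rfl, rfl, rfl⟩
  · exact ⟨-g, by omega, fun e => absurd e hn1, .of_first hx ht hz hy (by linarith)
      (by linarith) (by linarith) (by linarith) hww⟩
  · exact ⟨g, hg, fun e => absurd e hn1, .of_second hx ht hz hy (by linarith) (by linarith)
      (by linarith) (by linarith) hww⟩
  · obtain ⟨g', hgg, hg'⟩ : ∃ g', g * g' = -3 ∧ (g' = 1 ∨ g' = -1 ∨ g' = 3 ∨ g' = -3) := by
      rcases hg with rfl | rfl | rfl | rfl
      exacts [⟨-3, by norm_num⟩, ⟨3, by norm_num⟩, ⟨-1, by norm_num⟩, ⟨1, by norm_num⟩]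
    exact ⟨g', hg', fun e => absurd e hn1, .of_third hgg hx ht hz hy (by linarith) (by linarith)
      (by linarith) (by linarith) hww⟩
  · obtain ⟨g', hgg, hg'⟩ : ∃ g', g * g' = 3 ∧ (g' = 1 ∨ g' = -1 ∨ g' = 3 ∨ g' = -3) := by
      rcases hg with rfl | rfl | rfl | rfl
      exacts [⟨3, by norm_num⟩, ⟨-3, by norm_num⟩, ⟨1, by norm_num⟩, ⟨-1, by norm_num⟩]
    exact ⟨g', hg', fun e => absurd e hn1, .of_fourth hgg hx ht hz hy (by linarith) (by linarith)
      (by linarith) (by linarith) hww⟩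

theorem exists_fourCover {n r s w : ℤ} (hn : Admissible n) (hc : IsCoprime r s)
    (hw : w ≠ 0) (h : r * s * (r - s) * (r - 4 * s) = n * w ^ 2) :
    ∃ g : ℤ, (g = 1 ∨ g = -1 ∨ g = 3 ∨ g = -3) ∧ (n = 1 → g = 1) ∧ FourCover n r s w g := by
  rcases lt_trichotomy s 0 with hs | rfl | hs
  · obtain ⟨g, h1, h2, M, e, a, b, h3⟩ := exists_fourCover_of_pos (r := -r) (s := -s) hn
      hc.neg_neg hw (by omega) (by rw [← h]; ring)
    simp only [even_two, Even.neg_pow] at h3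
    exact ⟨g, h1, h2, M, e, a, b, h3⟩
  · have := hn.1
    have : n * w ^ 2 ≠ 0 := by positivity
    exact absurd (by rw [← h]; ring) this
  · exact exists_fourCover_of_pos hn hc hw hs h

theorem exists_gcd_decomposition {x y : ℤ} (hx : x ≠ 0) :
    ∃ d x' y' : ℤ, d ≠ 0 ∧ x = d * x' ∧ y = d * y' ∧ IsCoprime x' y' := by
  have hg : Int.gcd x y ≠ 0 := by simp [hx]
  obtain ⟨x', y', hco, h1, h2⟩ := Int.exists_gcd_one (Nat.pos_of_ne_zero hg)
  exact ⟨Int.gcd x y, x', y', by exact_mod_cast hg, by linarith, by linarith,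
    Int.isCoprime_iff_gcd_eq_one.mpr hco⟩

theorem squarefree_of_four_cases {g : ℤ} (hg : g = 1 ∨ g = -1 ∨ g = 3 ∨ g = -3) :
    Squarefree g := by
  apply squarefree_of_dvd_six
  rcases hg with rfl | rfl | rfl | rfl <;> norm_num

theorem FourCover.normalize {n r s w g : ℤ} (hg : g = 1 ∨ g = -1 ∨ g = 3 ∨ g = -3)
    (h : FourCover n r s w g) :
    ∃ M e a b : ℤ, IsCoprime M e ∧ M ≠ 0 ∧ e ≠ 0 ∧ a ≠ 0 ∧ b ≠ 0 ∧
      M ^ 2 - n * e ^ 2 = g * a ^ 2 ∧ M ^ 2 - 4 * (n * e ^ 2) = g * b ^ 2 ∧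
      (g = 1 → (M ^ 4 - 4 * n ^ 2 * e ^ 4) * w = (r ^ 2 - 4 * s ^ 2) * (M * a * b * e) ∨
        (M ^ 4 - 4 * n ^ 2 * e ^ 4) * w = -((r ^ 2 - 4 * s ^ 2) * (M * a * b * e))) := by
  obtain ⟨M, e, a, b, hM, he, ha, hb, h1, h2, h3⟩ := h
  have hsq := squarefree_of_four_cases hg
  obtain ⟨d, M, e, hd, rfl, rfl, hco⟩ := exists_gcd_decomposition (y := e) hM
  obtain ⟨a, rfl⟩ : d ∣ a := dvd_of_sq_dvd_mul_sq hsq ⟨M ^ 2 - n * e ^ 2, by rw [← h1]; ring⟩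
  obtain ⟨b, rfl⟩ : d ∣ b := dvd_of_sq_dvd_mul_sq hsq ⟨M ^ 2 - 4 * (n * e ^ 2), by
    rw [← h2]; ring⟩
  refine ⟨M, e, a, b, hco, right_ne_zero_of_mul hM, right_ne_zero_of_mul he,
    right_ne_zero_of_mul ha, right_ne_zero_of_mul hb, ?_, ?_, fun hg1 => ?_⟩
  · exact mul_left_cancel₀ (pow_ne_zero 2 hd) (by linear_combination h1)
  · exact mul_left_cancel₀ (pow_ne_zero 2 hd) (by linear_combination h2)
  · rcases h3 hg1 with h3 | h3
    · exact Or.inl (mul_left_cancel₀ (pow_ne_zero 4 hd) (by linear_combination h3))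
    · exact Or.inr (mul_left_cancel₀ (pow_ne_zero 4 hd) (by linear_combination h3))

theorem exists_trivial_fourCover {p : ℕ} [Fact p.Prime] (hmod : p % 24 = 1)
    (hr : ¬∃ w : ZMod p, w ^ 4 - 2 * w ^ 2 - 2 = 0) {n r s w : ℤ} (hn : n = 1 ∨ n = p)
    (hc : IsCoprime r s) (hw : w ≠ 0) (h : r * s * (r - s) * (r - 4 * s) = n * w ^ 2) :
    ∃ M e a b : ℤ, IsCoprime M e ∧ M ≠ 0 ∧ e ≠ 0 ∧ a ≠ 0 ∧ b ≠ 0 ∧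
      M ^ 2 - n * e ^ 2 = a ^ 2 ∧ M ^ 2 - 4 * (n * e ^ 2) = b ^ 2 ∧
      ((M ^ 4 - 4 * n ^ 2 * e ^ 4) * w = (r ^ 2 - 4 * s ^ 2) * (M * a * b * e) ∨
        (M ^ 4 - 4 * n ^ 2 * e ^ 4) * w = -((r ^ 2 - 4 * s ^ 2) * (M * a * b * e))) := by
  have had : Admissible n := by
    rcases hn with rfl | rfl
    exacts [Admissible.one, Admissible.of_nat_prime Fact.out hmod]
  obtain ⟨g, hg, hg1, hF⟩ := exists_fourCover had hc hw h
  obtain ⟨M, e, a, b, hco, hM, he, ha, hb, h1, h2, h3⟩ := hF.normalize hg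
  obtain rfl : g = 1 := by
    rcases hn with hn | rfl
    · exact hg1 hn
    rcases hg with rfl | rfl | rfl | rfl
    · rfl
    · exact (obstruction_neg_one hmod hr hco (a := a) (b := b) (by linarith) (by linarith)).elim
    · exact (obstruction_three hmod hr hco (a := a) (b := b) (by linarith) (by linarith)).elim
    · exact (obstruction_neg_three hmod hr hco (a := a) (b := b) (by linarith)
        (by linarith)).elim
  exact ⟨M, e, a, b, hco, hM, he, ha, hb, by linarith, by linarith, h3 rfl⟩

theorem natAbs_lt_of_two_mul_dvd {e e' : ℤ} (he : e ≠ 0) (h : 2 * e' ∣ e) :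
    e'.natAbs < e.natAbs := by
  have h1 := Int.natAbs_dvd_natAbs.mpr h
  have h2 := Nat.le_of_dvd (Int.natAbs_pos.mpr he) h1
  rw [Int.natAbs_mul] at h2
  have : e.natAbs ≠ 0 := by omega
  have h3 : e'.natAbs ≠ 0 := by
    intro h0
    rw [Int.natAbs_mul, h0, mul_zero, zero_dvd_iff] at h1
    exact this h1
  simp at h2
  omega

theorem IsCoprime.two_mul_of_odd {x y : ℤ} (hx : x % 2 = 1) (h : IsCoprime x y) :
    IsCoprime x (2 * y) :=
  IsCoprime.mul_right (⟨1, -(x / 2), by omega⟩) h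

theorem not_trivial_fourCover_of_pos {p : ℕ} [Fact p.Prime] (hmod : p % 24 = 1)
    (hr : ¬∃ w : ZMod p, w ^ 4 - 2 * w ^ 2 - 2 = 0) {n : ℤ} (hn : n = 1 ∨ n = p) (k : ℕ) :
    ∀ M e a b : ℤ, e.natAbs = k → IsCoprime M e → 0 < M → e ≠ 0 → 0 < a → 0 < b →
      M ^ 2 - n * e ^ 2 = a ^ 2 → M ^ 2 - 4 * (n * e ^ 2) = b ^ 2 → False := by
  have had : Admissible n := by
    rcases hn with rfl | rfl
    exacts [Admissible.one, Admissible.of_nat_prime Fact.out hmod]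
  induction k using Nat.strong_induction_on with
  | _ k ih =>
  intro M e a b hk hco hM he ha hb h1 h2
  have hne : n * e ^ 2 ≠ 0 := mul_ne_zero had.1.ne' (pow_ne_zero 2 he)
  obtain ⟨r, hrdef⟩ : ∃ r, r = (M + a) * (M + b) := ⟨_, rfl⟩
  obtain ⟨s, hsdef⟩ : ∃ s, s = n * e ^ 2 := ⟨_, rfl⟩
  obtain ⟨w, hwdef⟩ : ∃ w, w = e * ((M + a) * (M + b) * (a + b)) := ⟨_, rfl⟩
  have hw : w ≠ 0 := by rw [hwdef]; positivity
  have hr0 : r ≠ 0 := by rw [hrdef]; positivity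
  have e1 : r - s = (M + a) * (a + b) := by rw [hrdef, hsdef]; linear_combination h1
  have e2 : r - 4 * s = (M + b) * (a + b) := by rw [hrdef, hsdef]; linear_combination h2
  have e3 : r * s * (r - s) * (r - 4 * s) = n * w ^ 2 := by
    rw [e1, e2, hrdef, hsdef, hwdef]; ring
  have e4 : (r ^ 2 - 4 * s ^ 2) * e = 2 * M * w := by
    have : r ^ 2 - 4 * s ^ 2 = r * (r - 4 * s) + 4 * s * (r - s) := by ring
    rw [this, e1, e2, hrdef, hsdef, hwdef]
    linear_combination (-(e * (M + a) * (a + b))) * h2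
  obtain ⟨d, r', s', hd, hr', hs', hco'⟩ := exists_gcd_decomposition (y := s) hr0
  obtain ⟨w', hw'⟩ : d ^ 2 ∣ w := dvd_of_sq_dvd_mul_sq had.squarefree
    ⟨r' * s' * (r' - s') * (r' - 4 * s'), by rw [← e3, hr', hs']; ring⟩
  have hd2 : d ^ 2 ≠ 0 := pow_ne_zero 2 hd
  have hd4 : d ^ 4 ≠ 0 := pow_ne_zero 4 hd
  have e5 : r' * s' * (r' - s') * (r' - 4 * s') = n * w' ^ 2 := by
    apply mul_left_cancel₀ hd4
    rw [hr', hs', hw'] at e3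
    linear_combination e3
  have hw0 : w' ≠ 0 := by rintro rfl; simp [hw'] at hw
  obtain ⟨M', e', a', b', hMe, hM', he', ha', hb', f1, f2, f3⟩ :=
    exists_trivial_fourCover hmod hr hn hco' hw0 e5
  have f4 : (M' ^ 4 - 4 * n ^ 2 * e' ^ 4) * e = 2 * M * (M' * a' * b' * e') ∨
      (M' ^ 4 - 4 * n ^ 2 * e' ^ 4) * e = -(2 * M * (M' * a' * b' * e')) := by
    rw [hr', hs'] at e4
    rcases f3 with f3 | f3
    · refine Or.inl (mul_left_cancel₀ hw ?_)
      rw [hw'] at e4 ⊢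
      linear_combination d ^ 2 * e * f3 + (M' * a' * b' * e') * e4
    · refine Or.inr (mul_left_cancel₀ hw ?_)
      rw [hw'] at e4 ⊢
      linear_combination d ^ 2 * e * f3 - (M' * a' * b' * e') * e4
  have hodd : M' % 2 = 1 := by
    have r1 := sq_emod_eight M'
    have r2 := sq_emod_eight a'
    have r4 := mul_sq_emod_eight had.2.1 e'
    have r5 := hMe.emod_two
    omega
  have hXodd : (M' ^ 4 - 4 * n ^ 2 * e' ^ 4) % 2 = 1 := by
    have : M' ^ 4 % 2 = 1 := by simp [pow_succ, Int.mul_emod, hodd]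
    rw [mul_assoc]
    omega
  have hXe : IsCoprime (M' ^ 4 - 4 * n ^ 2 * e' ^ 4) e' := by
    have := (hMe.pow_left (m := 4)).add_mul_right_left (-(4 * n ^ 2 * e' ^ 3))
    rwa [show M' ^ 4 + -(4 * n ^ 2 * e' ^ 3) * e' = M' ^ 4 - 4 * n ^ 2 * e' ^ 4 by ring] at this
  have hdvd : 2 * e' ∣ e := by
    refine (hXe.two_mul_of_odd hXodd).symm.dvd_of_dvd_mul_left (?_ : _ ∣ _ * _)
    rcases f4 with f4 | f4 <;> rw [f4]
    · exact ⟨M * (M' * a' * b'), by ring⟩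
    · exact ⟨-(M * (M' * a' * b')), by ring⟩
  have hlt := natAbs_lt_of_two_mul_dvd he hdvd
  rw [hk] at hlt
  refine ih _ hlt |M'| e' |a'| |b'| rfl ?_ (abs_pos.mpr hM') he' (abs_pos.mpr ha')
    (abs_pos.mpr hb') (by rw [sq_abs, sq_abs, f1]) (by rw [sq_abs, sq_abs, f2])
  exact hMe.abs_left

theorem eq_zero_of_four {p : ℕ} [Fact p.Prime] (hmod : p % 24 = 1)
    (hr : ¬∃ w : ZMod p, w ^ 4 - 2 * w ^ 2 - 2 = 0) {n r s w : ℤ} (hn : n = 1 ∨ n = p)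
    (h : r * s * (r - s) * (r - 4 * s) = n * w ^ 2) : w = 0 := by
  by_contra hw
  have had : Admissible n := by
    rcases hn with rfl | rfl
    exacts [Admissible.one, Admissible.of_nat_prime Fact.out hmod]
  have hr0 : r ≠ 0 := by
    rintro rfl
    have := mul_ne_zero had.1.ne' (pow_ne_zero 2 hw)
    exact this (by rw [← h]; ring)
  obtain ⟨d, r, s, hd, rfl, rfl, hco⟩ := exists_gcd_decomposition (y := s) hr0
  obtain ⟨w, rfl⟩ : d ^ 2 ∣ w := dvd_of_sq_dvd_mul_sq had.squarefree
    ⟨r * s * (r - s) * (r - 4 * s), by rw [← h]; ring⟩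
  obtain ⟨M, e, a, b, hMe, hM, he, ha, hb, f1, f2, -⟩ :=
    exists_trivial_fourCover hmod hr hn hco (right_ne_zero_of_mul hw)
      (mul_left_cancel₀ (pow_ne_zero 4 hd) (by linear_combination h))
  exact not_trivial_fourCover_of_pos hmod hr hn _ |M| e |a| |b| rfl hMe.abs_left
    (abs_pos.mpr hM) he (abs_pos.mpr ha) (abs_pos.mpr hb) (by rw [sq_abs, sq_abs, f1])
    (by rw [sq_abs, sq_abs, f2])

/-- The torsor `b² = a² + n e²`, `c² = a² - 2 n e²` with a point over `(r : s : w)` up to sign. -/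
def PlusCover (n r s w : ℤ) : Prop :=
  ∃ e a b c : ℤ, e ≠ 0 ∧ a ≠ 0 ∧ b ≠ 0 ∧ c ≠ 0 ∧ b ^ 2 = a ^ 2 + n * e ^ 2 ∧
    c ^ 2 = a ^ 2 - 2 * (n * e ^ 2) ∧
    ((a ^ 4 + 2 * n ^ 2 * e ^ 4) * w = (r ^ 2 + 2 * s ^ 2) * (a * b * c * e) ∨
      (a ^ 4 + 2 * n ^ 2 * e ^ 4) * w = -((r ^ 2 + 2 * s ^ 2) * (a * b * c * e)))

theorem PlusCover.mk_of_eq {n r s w κ e a b c : ℤ} (he : e ≠ 0) (ha : a ≠ 0) (hb : b ≠ 0)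
    (hc : c ≠ 0) (h1 : b ^ 2 = a ^ 2 + n * e ^ 2) (h2 : c ^ 2 = a ^ 2 - 2 * (n * e ^ 2))
    (hT : r ^ 2 + 2 * s ^ 2 = κ * (a ^ 4 + 2 * n ^ 2 * e ^ 4))
    (hw : w = κ * (a * b * c * e) ∨ w = -(κ * (a * b * c * e))) : PlusCover n r s w := by
  refine ⟨e, a, b, c, he, ha, hb, hc, h1, h2, ?_⟩
  rw [hT]
  rcases hw with rfl | rfl
  · left; ring
  · right; ring

theorem exists_factorization_plus {n r s w : ℤ} (hn : Admissible n) (hc : IsCoprime r s)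
    (hw : w ≠ 0) (hs : 0 < s) (h : r * s * (r + s) * (r - 2 * s) = n * w ^ 2) :
    ∃ d₁ d₂ m₁ m₂ m₃ m₄ x t z y : ℤ, (d₁ = 1 ∨ d₁ = -1 ∨ d₁ = 2 ∨ d₁ = -2) ∧
      (d₂ = 1 ∨ d₂ = 3) ∧ (x ≠ 0 ∧ t ≠ 0 ∧ z ≠ 0 ∧ y ≠ 0) ∧
      OneIs n m₁ m₂ m₃ m₄ ∧ r = d₁ * (m₁ * x ^ 2) ∧ s = m₂ * t ^ 2 ∧
      r + s = d₂ * (m₃ * z ^ 2) ∧ r - 2 * s = d₁ * (d₂ * (m₄ * y ^ 2)) := by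
  have hn0 : 0 < n := hn.1
  have hw2 : 0 < n * w ^ 2 := by positivity
  have hne : r * s * (r + s) * (r - 2 * s) ≠ 0 := by rw [h]; positivity
  have hrs0 : 0 < r + s := by
    by_contra hr
    have e1 : 0 < r * (r - 2 * s) := by nlinarith
    have e2 : (r + s) * s ≤ 0 := by nlinarith
    nlinarith [mul_nonneg e1.le (neg_nonneg.mpr e2)]
  have hrs : ∀ q : ℤ, Prime q → q ∣ r → q ∣ s → False := fun q hq h1 h2 => hc.false_of_prime hq h1 h2
  obtain ⟨d1, m1, x, h1, hd1, hm1⟩ := exists_eq_mul_sq_of_mul_eq (D := 2) (x := r)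
    (y := s * (r + s) * (r - 2 * s)) hn (by norm_num) (by rw [← h]; ring) hw
    (fun q hq hq1 hq2 => by
      rcases hq.dvd_or_dvd hq2 with hq2 | hq2
      · rcases hq.dvd_or_dvd hq2 with hq2 | hq2
        · exact (hrs q hq hq1 hq2).elim
        · exact (hrs q hq hq1 (dvd_of_eq_add hq1 hq2 (u := -1) (v := 1) (by ring))).elim
      · have : q ∣ 2 * s := dvd_of_eq_add hq1 hq2 (u := 1) (v := -1) (by ring)
        exact (hq.dvd_or_dvd this).resolve_right (hrs q hq hq1))
  obtain ⟨d2, m2, t, h2, hd2, hm2⟩ := exists_eq_mul_sq_of_mul_eq (D := 1) (x := s)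
    (y := r * (r + s) * (r - 2 * s)) hn (by norm_num) (by rw [← h]; ring) hw
    (fun q hq hq1 hq2 => by
      exfalso
      rcases hq.dvd_or_dvd hq2 with hq2 | hq2
      · rcases hq.dvd_or_dvd hq2 with hq2 | hq2
        · exact hrs q hq hq2 hq1
        · exact hrs q hq (dvd_of_eq_add hq1 hq2 (u := -1) (v := 1) (by ring)) hq1
      · exact hrs q hq (dvd_of_eq_add hq1 hq2 (u := 2) (v := 1) (by ring)) hq1)
  obtain ⟨d3, m3, z, h3, hd3, hm3⟩ := exists_eq_mul_sq_of_mul_eq (D := 3) (x := r + s)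
    (y := r * s * (r - 2 * s)) hn (by norm_num) (by rw [← h]; ring) hw
    (fun q hq hq1 hq2 => by
      rcases hq.dvd_or_dvd hq2 with hq2 | hq2
      · exfalso
        rcases hq.dvd_or_dvd hq2 with hq2 | hq2
        · exact hrs q hq hq2 (dvd_of_eq_add hq1 hq2 (u := 1) (v := -1) (by ring))
        · exact hrs q hq (dvd_of_eq_add hq1 hq2 (u := 1) (v := -1) (by ring)) hq2
      · have : q ∣ 3 * s := dvd_of_eq_add hq1 hq2 (u := 1) (v := -1) (by ring)
        refine (hq.dvd_or_dvd this).resolve_right fun h => ?_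
        exact hrs q hq (dvd_of_eq_add hq1 h (u := 1) (v := -1) (by ring)) h)
  have hm20 : 0 < m2 := by rcases hm2 with rfl | rfl <;> omega
  have hm30 : 0 < m3 := by rcases hm3 with rfl | rfl <;> omega
  obtain rfl : d2 = 1 := by
    rcases dvd_six_cases hd2 (by norm_num) with rfl | rfl | h | h
    · rfl
    · nlinarith [sq_nonneg t]
    · omega
    · omega
  have hx : x ≠ 0 := by
    rintro rfl
    apply hne; rw [show r = 0 by simpa using h1]; ring
  have ht : t ≠ 0 := by rintro rfl; simp at h2; omega
  have hz : z ≠ 0 := by rintro rfl; simp at h3; omega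
  have hd1' : d1 = 1 ∨ d1 = -1 ∨ d1 = 2 ∨ d1 = -2 := by
    rcases dvd_six_cases hd1 (by norm_num) with h | h | h | h <;> omega
  have hd3' : d3 = 1 ∨ d3 = 3 := by
    have : 0 < d3 := by
      by_contra hd
      have : 0 ≤ m3 * z ^ 2 := by positivity
      nlinarith
    rcases dvd_six_cases hd3 (by norm_num) with h | h | h | h <;> omega
  have hdd : d1 * d3 ∣ 6 := mul_dvd_mul hd1 hd3
  have a1 : m1 = n → n ∣ r := fun e => by rw [h1, e]; exact ⟨d1 * x ^ 2, by ring⟩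
  have a2 : m2 = n → n ∣ s := fun e => by rw [h2, e]; exact ⟨1 * t ^ 2, by ring⟩
  have a3 : m3 = n → n ∣ r + s := fun e => by rw [h3, e]; exact ⟨d3 * z ^ 2, by ring⟩
  obtain ⟨m4, y, h4, hcases⟩ := exists_fourth_factor (v := r - 2 * s) (Z := x * t * z) hn hdd
    (by positivity) hm1 hm2 hm3
    (fun h0 e1 e2 => hrs n (hn.2.2.resolve_left h0) (a1 e1) (a2 e2))
    (fun h0 e1 e3 => hrs n (hn.2.2.resolve_left h0) (a1 e1) ((dvd_add_right (a1 e1)).mp (a3 e3)))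
    (fun h0 e2 e3 => hrs n (hn.2.2.resolve_left h0) ((dvd_add_left (a2 e2)).mp (a3 e3)) (a2 e2))
    (show _ = n * w ^ 2 by
      rw [← h]
      linear_combination (-(s * (r + s) * (r - 2 * s))) * h1 -
        (d1 * m1 * x ^ 2 * (r + s) * (r - 2 * s)) * h2 -
        (d1 * m1 * x ^ 2 * (m2 * t ^ 2) * (r - 2 * s)) * h3)
  have hy : y ≠ 0 := by
    rintro rfl
    apply hne; rw [show r - 2 * s = 0 by simpa using h4]; ring
  exact ⟨d1, d3, m1, m2, m3, m4, x, t, z, y, hd1', hd3', ⟨hx, ht, hz, hy⟩, hcases,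
    by linear_combination h1, by linear_combination h2, by linear_combination h3,
    by linear_combination h4⟩

theorem plus_class_cases {r s A B C D d₁ d₂ : ℤ} (hc : IsCoprime r s)
    (hd₁ : d₁ = 1 ∨ d₁ = -1 ∨ d₁ = 2 ∨ d₁ = -2) (hd₂ : d₂ = 1 ∨ d₂ = 3)
    (hB : B % 2 = 1 → B % 8 = 1)
    (hC : C % 8 = 0 ∨ C % 8 = 1 ∨ C % 8 = 4) (hD : D % 8 = 0 ∨ D % 8 = 1 ∨ D % 8 = 4)
    (hA3 : A % 3 = 0 ∨ A % 3 = 1) (hB3 : B % 3 = 0 ∨ B % 3 = 1)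
    (hC9 : C % 3 = 1 ∨ C % 9 = 0) (hD9 : D % 3 = 1 ∨ D % 9 = 0)
    (h1 : r = d₁ * A) (h2 : s = B) (h3 : r + s = d₂ * C) (h4 : r - 2 * s = d₁ * (d₂ * D)) :
    (d₁ = 1 ∧ d₂ = 1) ∨ (d₁ = -2 ∧ d₂ = 1) ∨ (d₁ = -1 ∧ d₂ = 3) ∨ (d₁ = 2 ∧ d₂ = 3) := by
  have hE := hc.emod_two
  subst h1 h2
  rcases hd₁ with rfl | rfl | rfl | rfl <;> rcases hd₂ with rfl | rfl
  · exact Or.inl ⟨rfl, rfl⟩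
  · exfalso
    clear hB hC hD hE
    exact hc.false_of_prime Int.prime_three (by omega) (by omega)
  · exfalso
    clear hB hC hD hE
    exact hc.false_of_prime Int.prime_three (by omega) (by omega)
  · exact Or.inr (Or.inr (Or.inl ⟨rfl, rfl⟩))
  · exfalso
    clear hA3 hB3
    have hBB : s % 8 = 1 := by omega
    clear hB hE
    have : A - s = D := by linarith
    have : 2 * A + s = C := by linarith
    clear h3 h4
    omega
  · exact Or.inr (Or.inr (Or.inr ⟨rfl, rfl⟩))
  · exact Or.inr (Or.inl ⟨rfl, rfl⟩)
  · exfalso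
    clear hB hC hD hE
    exact hc.false_of_prime Int.prime_three (by omega) (by omega)

theorem mul_sq_emod_nine {m : ℤ} (hm : m % 24 = 1) (x : ℤ) :
    m * x ^ 2 % 3 = 1 ∨ m * x ^ 2 % 9 = 0 := by
  have h : x % 3 = 0 ∨ x % 3 = 1 ∨ x % 3 = 2 := by omega
  have hm' : m % 3 = 1 := by omega
  rcases h with h | h | h
  · right
    obtain ⟨y, rfl⟩ : (3 : ℤ) ∣ x := by omega
    rw [show m * (3 * y) ^ 2 = 9 * (m * y ^ 2) by ring]
    omega
  · left; simp [pow_two, Int.mul_emod, h, hm']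
  · left; simp [pow_two, Int.mul_emod, h, hm']

theorem PlusCover.of_second {n r s w x t z y : ℤ} (hx : x ≠ 0) (ht : t ≠ 0) (hz : z ≠ 0)
    (hy : y ≠ 0) (h1 : r = 1 * x ^ 2) (h2 : s = n * t ^ 2) (h3 : r + s = 1 * z ^ 2)
    (h4 : r - 2 * s = 1 * (1 * y ^ 2))
    (hw : w = 1 * (x * t * z * y) ∨ w = -(1 * (x * t * z * y))) : PlusCover n r s w :=
  .mk_of_eq (κ := 1) ht hx hz hy (by linarith) (by linarith) (by rw [h1, h2]; ring)
    (hw.imp (fun h => by rw [h]; ring) (fun h => by rw [h]; ring))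

theorem PlusCover.of_first {n r s w x t z y : ℤ} (hx : x ≠ 0) (ht : t ≠ 0) (hz : z ≠ 0)
    (hy : y ≠ 0) (h1 : r = -2 * (n * x ^ 2)) (h2 : s = t ^ 2) (h3 : r + s = z ^ 2)
    (h4 : r - 2 * s = -2 * y ^ 2)
    (hw : w = -2 * (x * t * z * y) ∨ w = -(-2 * (x * t * z * y))) : PlusCover n r s w :=
  .mk_of_eq (κ := 2) hx ht hy hz (by linarith) (by linarith) (by rw [h1, h2]; ring)
    (hw.symm.imp (fun h => by rw [h]; ring) (fun h => by rw [h]; ring))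

theorem PlusCover.of_third {n r s w x t z y : ℤ} (hx : x ≠ 0) (ht : t ≠ 0) (hz : z ≠ 0)
    (hy : y ≠ 0) (h1 : r = -x ^ 2) (h2 : s = t ^ 2) (h3 : r + s = 3 * (n * z ^ 2))
    (h4 : r - 2 * s = -3 * y ^ 2)
    (hw : w = -3 * (x * t * z * y) ∨ w = -(-3 * (x * t * z * y))) : PlusCover n r s w := by
  have h5 : r = 2 * (n * z ^ 2) - y ^ 2 := by linarith
  have h6 : s = n * z ^ 2 + y ^ 2 := by linarith
  exact .mk_of_eq (κ := 3) hz hy ht hx (by linarith) (by linarith) (by rw [h5, h6]; ring)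
    (hw.symm.imp (fun h => by rw [h]; ring) (fun h => by rw [h]; ring))

theorem PlusCover.of_fourth {n r s w x t z y : ℤ} (hx : x ≠ 0) (ht : t ≠ 0) (hz : z ≠ 0)
    (hy : y ≠ 0) (h1 : r = 2 * x ^ 2) (h2 : s = t ^ 2) (h3 : r + s = 3 * z ^ 2)
    (h4 : r - 2 * s = 6 * (n * y ^ 2))
    (hw : w = 6 * (x * t * z * y) ∨ w = -(6 * (x * t * z * y))) : PlusCover n r s w := by
  have h5 : r = 2 * z ^ 2 + 2 * (n * y ^ 2) := by linarith
  have h6 : s = z ^ 2 - 2 * (n * y ^ 2) := by linarith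
  exact .mk_of_eq (κ := 6) hy hz hx ht (by linarith) (by linarith) (by rw [h5, h6]; ring)
    (hw.imp (fun h => by rw [h]; ring) (fun h => by rw [h]; ring))

theorem exists_plusCover_of_pos {p : ℕ} [Fact p.Prime] (hmod : p % 24 = 1)
    (hr : ¬∃ w : ZMod p, w ^ 4 - 2 * w ^ 2 - 2 = 0) {n r s w : ℤ} (hn : n = 1 ∨ n = p)
    (hc : IsCoprime r s) (hw : w ≠ 0) (hs : 0 < s)
    (h : r * s * (r + s) * (r - 2 * s) = n * w ^ 2) : PlusCover n r s w := by
  have had : Admissible n := by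
    rcases hn with rfl | rfl
    exacts [Admissible.one, Admissible.of_nat_prime Fact.out hmod]
  obtain ⟨d₁, d₂, m₁, m₂, m₃, m₄, x, t, z, y, hd₁, hd₂, ⟨hx, ht, hz, hy⟩, hm, h1, h2, h3, h4⟩ :=
    exists_factorization_plus had hc hw hs h
  have hmod' : m₁ % 24 = 1 ∧ m₂ % 24 = 1 ∧ m₃ % 24 = 1 ∧ m₄ % 24 = 1 := by
    have := had.2.1
    unfold OneIs at hm
    omega
  have hmm : m₁ * m₂ * m₃ * m₄ = n := by
    rcases hm with ⟨e1, e2, e3, e4⟩ | ⟨e1, e2, e3, e4⟩ | ⟨e1, e2, e3, e4⟩ | ⟨e1, e2, e3, e4⟩ <;>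
      rw [e1, e2, e3, e4] <;> ring
  have hcl : (d₁ = 1 ∧ d₂ = 1) ∨ (d₁ = -2 ∧ d₂ = 1) ∨ (d₁ = -1 ∧ d₂ = 3) ∨ (d₁ = 2 ∧ d₂ = 3) := by
    have A := mul_sq_emod_eight hmod'.1 x
    have B := mul_sq_emod_eight hmod'.2.1 t
    have C := mul_sq_emod_eight hmod'.2.2.1 z
    have D := mul_sq_emod_eight hmod'.2.2.2 y
    have A' := mul_sq_emod_nine hmod'.1 x
    have B' := mul_sq_emod_nine hmod'.2.1 t
    have C' := mul_sq_emod_nine hmod'.2.2.1 z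
    have D' := mul_sq_emod_nine hmod'.2.2.2 y
    exact plus_class_cases hc hd₁ hd₂ (by omega) (by omega) (by omega) (by omega) (by omega) C' D'
      h1 h2 h3 h4
  have hww : w = d₁ * d₂ * (x * t * z * y) ∨ w = -(d₁ * d₂ * (x * t * z * y)) := by
    apply eq_or_eq_neg_of_mul_sq_eq had.1.ne'
    rw [← h, h4, h3, h2, h1, ← hmm]
    ring
  have hxt : ∀ q : ℤ, Prime q → ¬ q ∣ 6 → q ∣ x → q ∣ t → False := fun q hq _ hqx hqt =>
    hc.false_of_prime hq (h1 ▸ (((hqx.pow two_ne_zero).mul_left _).mul_left _))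
      (h2 ▸ ((hqt.pow two_ne_zero).mul_left _))
  have hzy : ∀ q : ℤ, Prime q → ¬ q ∣ 6 → q ∣ z → q ∣ y → False := fun q hq hq6 hqz hqy => by
    have e1 : q ∣ r + s := h3 ▸ (((hqz.pow two_ne_zero).mul_left _).mul_left _)
    have e2 : q ∣ r - 2 * s := h4 ▸ ((((hqy.pow two_ne_zero).mul_left _).mul_left _).mul_left _)
    have e3 : q ∣ 3 * s := dvd_of_eq_add e1 e2 (u := 1) (v := -1) (by ring)
    have e4 : q ∣ s := (hq.dvd_or_dvd e3).resolve_left fun h => hq6 (h.trans (by norm_num))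
    exact hc.false_of_prime hq (dvd_of_eq_add e1 e4 (u := 1) (v := -1) (by ring)) e4
  rcases hn with rfl | rfl
  · obtain ⟨rfl, rfl, rfl, rfl⟩ : m₁ = 1 ∧ m₂ = 1 ∧ m₃ = 1 ∧ m₄ = 1 := by
      unfold OneIs at hm; omega
    rcases hcl with ⟨rfl, rfl⟩ | ⟨rfl, rfl⟩ | ⟨rfl, rfl⟩ | ⟨rfl, rfl⟩
    · exact .of_second hx ht hz hy (by linarith) (by linarith) (by linarith) (by linarith) hww
    · exact .of_first hx ht hz hy (by linarith) (by linarith) (by linarith) (by linarith) hww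
    · exact .of_third hx ht hz hy (by linarith) (by linarith) (by linarith) (by linarith) hww
    · exact .of_fourth hx ht hz hy (by linarith) (by linarith) (by linarith) (by linarith) hww
  rcases hcl with ⟨rfl, rfl⟩ | ⟨rfl, rfl⟩ | ⟨rfl, rfl⟩ | ⟨rfl, rfl⟩ <;>
    rcases hm with ⟨rfl, rfl, rfl, rfl⟩ | ⟨rfl, rfl, rfl, rfl⟩ | ⟨rfl, rfl, rfl, rfl⟩ |
      ⟨rfl, rfl, rfl, rfl⟩
  · exact (obstruction_neg_two_one hmod hr (e := x) (a := t) (b := y) (c := z)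
      (fun q hq h6 i j => hxt q hq h6 j i) (by linarith) (by linarith)).elim
  · exact .of_second hx ht hz hy (by linarith) (by linarith) (by linarith) (by linarith) hww
  · exact (obstruction_neg_one_three hmod hr (e := z) (a := y) (b := t) (c := x)
      (fun q hq h6 i j => hzy q hq h6 j i) (by linarith) (by linarith)).elim
  · exact (obstruction_two_three hmod hr (e := y) (a := z) (b := x) (c := t) hx hzy
      (by linarith) (by linarith)).elim
  · exact .of_first hx ht hz hy (by linarith) (by linarith) (by linarith) (by linarith) hww
  · exact (obstruction_neg_two_one hmod hr (e := t) (a := x) (b := z) (c := y) hxt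
      (by linarith) (by linarith)).elim
  · exact (obstruction_two_three hmod hr (e := z) (a := y) (b := t) (c := x) ht
      (fun q hq h6 i j => hzy q hq h6 j i) (by linarith) (by linarith)).elim
  · exact (obstruction_neg_one_three hmod hr (e := y) (a := z) (b := x) (c := t) hzy
      (by linarith) (by linarith)).elim
  · exact (obstruction_two_three hmod hr (e := x) (a := t) (b := y) (c := z) hy
      (fun q hq h6 i j => hxt q hq h6 j i) (by linarith) (by linarith)).elim
  · exact (obstruction_neg_one_three hmod hr (e := t) (a := x) (b := z) (c := y) hxt
      (by linarith) (by linarith)).elim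
  · exact .of_third hx ht hz hy (by linarith) (by linarith) (by linarith) (by linarith) hww
  · exact (obstruction_neg_two_one hmod hr (e := y) (a := z) (b := x) (c := t) hzy
      (by linarith) (by linarith)).elim
  · exact (obstruction_neg_one_three hmod hr (e := x) (a := t) (b := y) (c := z)
      (fun q hq h6 i j => hxt q hq h6 j i) (by linarith) (by linarith)).elim
  · exact (obstruction_two_three hmod hr (e := t) (a := x) (b := z) (c := y) hz hxt
      (by linarith) (by linarith)).elim
  · exact (obstruction_neg_two_one hmod hr (e := z) (a := y) (b := t) (c := x)
      (fun q hq h6 i j => hzy q hq h6 j i) (by linarith) (by linarith)).elim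
  · exact .of_fourth hx ht hz hy (by linarith) (by linarith) (by linarith) (by linarith) hww

theorem exists_plusCover {p : ℕ} [Fact p.Prime] (hmod : p % 24 = 1)
    (hr : ¬∃ w : ZMod p, w ^ 4 - 2 * w ^ 2 - 2 = 0) {n r s w : ℤ} (hn : n = 1 ∨ n = p)
    (hc : IsCoprime r s) (hw : w ≠ 0) (h : r * s * (r + s) * (r - 2 * s) = n * w ^ 2) :
    PlusCover n r s w := by
  rcases lt_trichotomy s 0 with hs | rfl | hs
  · obtain ⟨e, a, b, c, h3⟩ := exists_plusCover_of_pos hmod hr (r := -r) (s := -s) hn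
      hc.neg_neg hw (by omega) (by rw [← h]; ring)
    simp only [even_two, Even.neg_pow] at h3
    exact ⟨e, a, b, c, h3⟩
  · have h0 : n ≠ 0 := by
      rcases hn with rfl | rfl
      exacts [one_ne_zero, by exact_mod_cast (Fact.out (p := p.Prime)).ne_zero]
    exact absurd (by rw [← h]; ring) (mul_ne_zero h0 (pow_ne_zero 2 hw))
  · exact exists_plusCover_of_pos hmod hr hn hc hw hs h

theorem PlusCover.normalize {n r s w : ℤ} (h : PlusCover n r s w) :
    ∃ e a b c : ℤ, IsCoprime a e ∧ e ≠ 0 ∧ a ≠ 0 ∧ b ≠ 0 ∧ c ≠ 0 ∧ b ^ 2 = a ^ 2 + n * e ^ 2 ∧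
      c ^ 2 = a ^ 2 - 2 * (n * e ^ 2) ∧
      ((a ^ 4 + 2 * n ^ 2 * e ^ 4) * w = (r ^ 2 + 2 * s ^ 2) * (a * b * c * e) ∨
        (a ^ 4 + 2 * n ^ 2 * e ^ 4) * w = -((r ^ 2 + 2 * s ^ 2) * (a * b * c * e))) := by
  obtain ⟨e, a, b, c, he, ha, hb, hc, h1, h2, h3⟩ := h
  obtain ⟨d, a, e, hd, rfl, rfl, hco⟩ := exists_gcd_decomposition (y := e) ha
  obtain ⟨b, rfl⟩ : d ∣ b := (Int.pow_dvd_pow_iff two_ne_zero).mp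
    ⟨a ^ 2 + n * e ^ 2, by rw [h1]; ring⟩
  obtain ⟨c, rfl⟩ : d ∣ c := (Int.pow_dvd_pow_iff two_ne_zero).mp
    ⟨a ^ 2 - 2 * (n * e ^ 2), by rw [h2]; ring⟩
  refine ⟨e, a, b, c, hco, right_ne_zero_of_mul he, right_ne_zero_of_mul ha,
    right_ne_zero_of_mul hb, right_ne_zero_of_mul hc, ?_, ?_, ?_⟩
  · exact mul_left_cancel₀ (pow_ne_zero 2 hd) (by linear_combination h1)
  · exact mul_left_cancel₀ (pow_ne_zero 2 hd) (by linear_combination h2)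
  · rcases h3 with h3 | h3
    · exact Or.inl (mul_left_cancel₀ (pow_ne_zero 4 hd) (by linear_combination h3))
    · exact Or.inr (mul_left_cancel₀ (pow_ne_zero 4 hd) (by linear_combination h3))

theorem not_plusCover_of_pos {p : ℕ} [Fact p.Prime] (hmod : p % 24 = 1)
    (hr : ¬∃ w : ZMod p, w ^ 4 - 2 * w ^ 2 - 2 = 0) {n : ℤ} (hn : n = 1 ∨ n = p) (k : ℕ) :
    ∀ e a b c : ℤ, e.natAbs = k → IsCoprime a e → e ≠ 0 → 0 < a → 0 < b → 0 < c →
      b ^ 2 = a ^ 2 + n * e ^ 2 → c ^ 2 = a ^ 2 - 2 * (n * e ^ 2) → False := by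
  have had : Admissible n := by
    rcases hn with rfl | rfl
    exacts [Admissible.one, Admissible.of_nat_prime Fact.out hmod]
  induction k using Nat.strong_induction_on with
  | _ k ih =>
  intro e a b c hk hco he ha hb hc h1 h2
  obtain ⟨r, hrdef⟩ : ∃ r, r = (a + b) * (a + c) := ⟨_, rfl⟩
  obtain ⟨s, hsdef⟩ : ∃ s, s = n * e ^ 2 := ⟨_, rfl⟩
  obtain ⟨w, hwdef⟩ : ∃ w, w = e * ((a + b) * (a + c) * (b + c)) := ⟨_, rfl⟩
  have hw : w ≠ 0 := by rw [hwdef]; positivity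
  have hr0 : r ≠ 0 := by rw [hrdef]; positivity
  have e1 : r + s = (a + b) * (b + c) := by rw [hrdef, hsdef]; linear_combination -h1
  have e2 : r - 2 * s = (a + c) * (b + c) := by rw [hrdef, hsdef]; linear_combination -h2
  have e3 : r * s * (r + s) * (r - 2 * s) = n * w ^ 2 := by
    rw [e1, e2, hrdef, hsdef, hwdef]; ring
  have e4 : (r ^ 2 + 2 * s ^ 2) * e = 2 * a * w := by
    have : r ^ 2 + 2 * s ^ 2 = r * (r - 2 * s) + 2 * s * (r + s) := by ring
    rw [this, e1, e2, hrdef, hsdef, hwdef]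
    linear_combination (e * (a + b) * (b + c)) * h2
  obtain ⟨d, r', s', hd, hr', hs', hco'⟩ := exists_gcd_decomposition (y := s) hr0
  obtain ⟨w', hw'⟩ : d ^ 2 ∣ w := dvd_of_sq_dvd_mul_sq had.squarefree
    ⟨r' * s' * (r' + s') * (r' - 2 * s'), by rw [← e3, hr', hs']; ring⟩
  have hd4 : d ^ 4 ≠ 0 := pow_ne_zero 4 hd
  have e5 : r' * s' * (r' + s') * (r' - 2 * s') = n * w' ^ 2 := by
    apply mul_left_cancel₀ hd4
    rw [hr', hs', hw'] at e3
    linear_combination e3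
  have hw0 : w' ≠ 0 := by rintro rfl; simp [hw'] at hw
  obtain ⟨e', a', b', c', hae, he', ha', hb', hc', f1, f2, f3⟩ :=
    (exists_plusCover hmod hr hn hco' hw0 e5).normalize
  have f4 : (a' ^ 4 + 2 * n ^ 2 * e' ^ 4) * e = 2 * a * (a' * b' * c' * e') ∨
      (a' ^ 4 + 2 * n ^ 2 * e' ^ 4) * e = -(2 * a * (a' * b' * c' * e')) := by
    rw [hr', hs'] at e4
    rcases f3 with f3 | f3
    · refine Or.inl (mul_left_cancel₀ hw ?_)
      rw [hw'] at e4 ⊢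
      linear_combination d ^ 2 * e * f3 + (a' * b' * c' * e') * e4
    · refine Or.inr (mul_left_cancel₀ hw ?_)
      rw [hw'] at e4 ⊢
      linear_combination d ^ 2 * e * f3 - (a' * b' * c' * e') * e4
  have hodd : a' % 2 = 1 := by
    have r1 := sq_emod_eight a'
    have r2 := sq_emod_eight b'
    have r3 := sq_emod_eight c'
    have r4 := mul_sq_emod_eight had.2.1 e'
    have r5 := hae.emod_two
    omega
  have hXodd : (a' ^ 4 + 2 * n ^ 2 * e' ^ 4) % 2 = 1 := by
    have : a' ^ 4 % 2 = 1 := by simp [pow_succ, Int.mul_emod, hodd]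
    rw [mul_assoc]
    omega
  have hXe : IsCoprime (a' ^ 4 + 2 * n ^ 2 * e' ^ 4) e' := by
    have := (hae.pow_left (m := 4)).add_mul_right_left (2 * n ^ 2 * e' ^ 3)
    rwa [show a' ^ 4 + (2 * n ^ 2 * e' ^ 3) * e' = a' ^ 4 + 2 * n ^ 2 * e' ^ 4 by ring] at this
  have hdvd : 2 * e' ∣ e := by
    refine (hXe.two_mul_of_odd hXodd).symm.dvd_of_dvd_mul_left (?_ : _ ∣ _ * _)
    rcases f4 with f4 | f4 <;> rw [f4]
    · exact ⟨a * (a' * b' * c'), by ring⟩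
    · exact ⟨-(a * (a' * b' * c')), by ring⟩
  have hlt := natAbs_lt_of_two_mul_dvd he hdvd
  rw [hk] at hlt
  exact ih _ hlt e' |a'| |b'| |c'| rfl hae.abs_left he' (abs_pos.mpr ha') (abs_pos.mpr hb')
    (abs_pos.mpr hc') (by rw [sq_abs, sq_abs, f1]) (by rw [sq_abs, sq_abs, f2])

theorem eq_zero_of_plus {p : ℕ} [Fact p.Prime] (hmod : p % 24 = 1)
    (hr : ¬∃ w : ZMod p, w ^ 4 - 2 * w ^ 2 - 2 = 0) {n r s w : ℤ} (hn : n = 1 ∨ n = p)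
    (h : r * s * (r + s) * (r - 2 * s) = n * w ^ 2) : w = 0 := by
  by_contra hw
  have had : Admissible n := by
    rcases hn with rfl | rfl
    exacts [Admissible.one, Admissible.of_nat_prime Fact.out hmod]
  have hr0 : r ≠ 0 := by
    rintro rfl
    exact mul_ne_zero had.1.ne' (pow_ne_zero 2 hw) (by rw [← h]; ring)
  obtain ⟨d, r, s, hd, rfl, rfl, hco⟩ := exists_gcd_decomposition (y := s) hr0
  obtain ⟨w, rfl⟩ : d ^ 2 ∣ w := dvd_of_sq_dvd_mul_sq had.squarefree
    ⟨r * s * (r + s) * (r - 2 * s), by rw [← h]; ring⟩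
  obtain ⟨e, a, b, c, hae, he, ha, hb, hc, f1, f2, -⟩ :=
    (exists_plusCover hmod hr hn hco (right_ne_zero_of_mul hw)
      (mul_left_cancel₀ (pow_ne_zero 4 hd) (by linear_combination h))).normalize
  exact not_plusCover_of_pos hmod hr hn _ e |a| |b| |c| rfl hae.abs_left he
    (abs_pos.mpr ha) (abs_pos.mpr hb) (abs_pos.mpr hc) (by rw [sq_abs, sq_abs, f1])
    (by rw [sq_abs, sq_abs, f2])

/-- `V` is a nonzero square or `p` times a nonzero square. -/
def SqUpTo (p V : ℤ) : Prop := ∃ n u : ℤ, (n = 1 ∨ n = p) ∧ u ≠ 0 ∧ V = n * u ^ 2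

theorem SqUpTo.mul {p a b : ℤ} (hp : p ≠ 0) (ha : SqUpTo p a) (hb : SqUpTo p b) :
    SqUpTo p (a * b) := by
  obtain ⟨m, u, hm, hu, rfl⟩ := ha
  obtain ⟨n, v, hn, hv, rfl⟩ := hb
  rcases hm with rfl | rfl
  · exact ⟨n, u * v, hn, mul_ne_zero hu hv, by ring⟩
  · rcases hn with rfl | rfl
    · exact ⟨m, u * v, Or.inr rfl, mul_ne_zero hu hv, by ring⟩
    · exact ⟨1, n * (u * v), Or.inl rfl, mul_ne_zero hp (mul_ne_zero hu hv), by ring⟩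

theorem SqUpTo.of_mul_sq {p a c : ℤ} (hp : Squarefree p) (h : SqUpTo p (a * c ^ 2)) :
    SqUpTo p a := by
  obtain ⟨n, u, hn, hu, h⟩ := h
  have hsq : Squarefree n := by
    rcases hn with rfl | rfl
    exacts [squarefree_one, hp]
  obtain ⟨u, rfl⟩ : c ∣ u := dvd_of_sq_dvd_mul_sq hsq ⟨a, by rw [← h]; ring⟩
  have hc := left_ne_zero_of_mul hu
  exact ⟨n, u, hn, right_ne_zero_of_mul hu,
    mul_right_cancel₀ (pow_ne_zero 2 hc) (by linear_combination h)⟩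

theorem SqUpTo.of_mul {p a b : ℤ} (hp : Prime p) (h : SqUpTo p (a * b)) (hb : SqUpTo p b) :
    SqUpTo p a :=
  SqUpTo.of_mul_sq (c := b) hp.squarefree (by
    have := h.mul hp.ne_zero hb
    rwa [show a * b * b = a * b ^ 2 by ring] at this)

theorem SqUpTo.ne_zero {p V : ℤ} (hp : p ≠ 0) (h : SqUpTo p V) : V ≠ 0 := by
  obtain ⟨n, u, hn, hu, rfl⟩ := h
  rcases hn with rfl | rfl <;> positivity

theorem SqUpTo.pos {p V : ℤ} (hp : 0 < p) (h : SqUpTo p V) : 0 < V := by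
  obtain ⟨n, u, hn, hu, rfl⟩ := h
  rcases hn with rfl | rfl <;> positivity

theorem SqUpTo.emod {p V : ℤ} (hp : p % 24 = 1) (h : SqUpTo p V) :
    V % 8 = 0 ∨ V % 8 = 1 ∨ V % 8 = 4 := by
  obtain ⟨n, u, hn, hu, rfl⟩ := h
  have : n % 24 = 1 := by omega
  have := mul_sq_emod_eight this u
  omega

theorem sqUpTo_of_emod_sixteen {p X d m v : ℤ} (hp : p % 24 = 1) (hX : 0 < X) (h4 : X % 16 = 4)
    (hd : d ∣ 6) (hm : m = 1 ∨ m = p) (h : X = d * m * v ^ 2) (hm0 : 0 < m) : SqUpTo p X := by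
  have hv : v ≠ 0 := by rintro rfl; simp at h; omega
  have hm1 : m % 24 = 1 := by omega
  have hT : 0 < m * v ^ 2 := by positivity
  have h' : X = d * (m * v ^ 2) := by rw [h]; ring
  have hd0 : 0 < d := by
    by_contra hd0
    nlinarith
  have hd6 : d ≤ 6 := Int.le_of_dvd (by norm_num) hd
  refine ⟨m, v, hm, hv, ?_⟩
  have r := mul_sq_emod_eight hm1 v
  have hcase : m * v ^ 2 % 2 = 1 ∨ m * v ^ 2 % 16 = 0 ∨ m * v ^ 2 % 16 = 4 := by
    rcases r with ⟨e, -⟩ | e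
    · obtain ⟨v, rfl⟩ : (2 : ℤ) ∣ v := by omega
      have := mul_sq_emod_eight hm1 v
      rw [show m * (2 * v) ^ 2 = 4 * (m * v ^ 2) by ring]
      omega
    · left; omega
  generalize m * v ^ 2 = T at *
  have : d = 1 ∨ d = 2 ∨ d = 3 ∨ d = 6 := by
    interval_cases d <;> revert hd <;> decide
  rcases this with rfl | rfl | rfl | rfl <;> omega

theorem not_sqUpTo_prime {p : ℕ} [Fact p.Prime] (hmod : p % 24 = 1)
    (hr : ¬∃ w : ZMod p, w ^ 4 - 2 * w ^ 2 - 2 = 0) {r s : ℤ} :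
    ¬ SqUpTo p (r * s * (r - s) * (r - 4 * s)) ∧ ¬ SqUpTo p (r * s * (r + s) * (r - 2 * s)) :=
  ⟨fun ⟨_, _, hn, hu, h⟩ => hu (eq_zero_of_four hmod hr hn h),
    fun ⟨_, _, hn, hu, h⟩ => hu (eq_zero_of_plus hmod hr hn h)⟩

theorem curve_case_one {p : ℕ} [Fact p.Prime] (hmod : p % 24 = 1)
    (hr : ¬∃ w : ZMod p, w ^ 4 - 2 * w ^ 2 - 2 = 0) {r s : ℤ}
    (hF : SqUpTo p (r * s * (r ^ 2 - s ^ 2) * (r ^ 2 - 4 * s ^ 2))) (hs : SqUpTo p s)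
    (hr1 : SqUpTo p r) : False := by
  have hp : Prime (p : ℤ) := Nat.prime_iff_prime_int.mp Fact.out
  have hA : SqUpTo p ((r ^ 2 - s ^ 2) * (r ^ 2 - 4 * s ^ 2)) :=
    SqUpTo.of_mul (b := r * s) hp (by convert hF using 1; ring) (hr1.mul hp.ne_zero hs)
  refine (not_sqUpTo_prime hmod hr (r := 4 * (r ^ 2 - s ^ 2)) (s := r ^ 2 - 4 * s ^ 2)).1 ?_
  have := (hA.mul hp.ne_zero (b := (12 * r * s) ^ 2) ⟨1, 12 * r * s, Or.inl rfl, ?_, by ring⟩)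
  · convert this using 1; ring
  · have := hr1.ne_zero hp.ne_zero
    have := hs.ne_zero hp.ne_zero
    positivity

theorem curve_case_neg_one {p : ℕ} [Fact p.Prime] (hmod : p % 24 = 1)
    (hr : ¬∃ w : ZMod p, w ^ 4 - 2 * w ^ 2 - 2 = 0) {r s w : ℤ} (hc : IsCoprime r s) (hw : w ≠ 0)
    (hF : r * s * (r ^ 2 - s ^ 2) * (r ^ 2 - 4 * s ^ 2) = p * w ^ 2) (hs : SqUpTo p s)
    (hr1 : SqUpTo p (-r)) : False := by
  have hp : Prime (p : ℤ) := Nat.prime_iff_prime_int.mp Fact.out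
  have hp0 : (0 : ℤ) < p := by exact_mod_cast (Fact.out (p := p.Prime)).pos
  have hm : (p : ℤ) % 24 = 1 := by omega
  have had : Admissible (p : ℤ) := Admissible.of_nat_prime Fact.out hmod
  have hF' : SqUpTo p (r * s * (r ^ 2 - s ^ 2) * (r ^ 2 - 4 * s ^ 2)) :=
    ⟨p, w, Or.inr rfl, hw, hF⟩
  have hA : SqUpTo p (-((r ^ 2 - s ^ 2) * (r ^ 2 - 4 * s ^ 2))) :=
    SqUpTo.of_mul (b := -r * s) hp (by convert hF' using 1; ring) (hr1.mul hp.ne_zero hs)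
  have hs0 := hs.pos hp0
  have hr0 := hr1.pos hp0
  have hr8 := hr1.emod hm
  have hs8 := hs.emod hm
  have hE := hc.emod_two
  have hodd : r % 2 = 1 := by
    by_contra hev
    obtain ⟨ρ, rfl⟩ : (4 : ℤ) ∣ r := by omega
    obtain ⟨j, rfl⟩ : ∃ j, s = 2 * j + 1 := ⟨s / 2, by omega⟩
    have hB : SqUpTo p (-(((4 * ρ) ^ 2 - (2 * j + 1) ^ 2) * (4 * ρ ^ 2 - (2 * j + 1) ^ 2))) :=
      SqUpTo.of_mul_sq (c := 2) hp.squarefree (by convert hA using 1; ring)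
    have hB8 := hB.emod hm
    have : -(((4 * ρ) ^ 2 - (2 * j + 1) ^ 2) * (4 * ρ ^ 2 - (2 * j + 1) ^ 2)) =
      4 * (-(16 * ρ ^ 4 - 5 * ρ ^ 2 * (2 * j + 1) ^ 2 + (j ^ 2 + j) * (4 * j ^ 2 + 4 * j + 2))) - 1 := by
      ring
    omega
  have hpos : 0 < r + 2 * s := by
    have h1 := hA.pos hp0
    by_contra h2
    have h3 : 0 ≤ r ^ 2 - 4 * s ^ 2 := by nlinarith
    have h4 : 0 ≤ r ^ 2 - s ^ 2 := by nlinarith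
    nlinarith [mul_nonneg h4 h3]
  have hrs : ∀ q : ℤ, Prime q → q ∣ r → q ∣ s → False := fun q hq h1 h2 => hc.false_of_prime hq h1 h2
  obtain ⟨d, m, v, h1, hd, hm1⟩ := exists_eq_mul_sq_of_mul_eq (D := 3) (x := r + 2 * s)
    (y := r * s * (r - s) * (r + s) * (r - 2 * s)) had (by norm_num) (by rw [← hF]; ring) hw
    (fun q hq hq1 hq2 => by
      have n2 : ¬ q ∣ 2 := fun h => not_dvd_two_of_dvd_odd hq hodd
        (dvd_of_eq_add hq1 h (u := 1) (v := -s) (by ring)) h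
      have ns : ¬ q ∣ s := fun h => hrs q hq
        (dvd_of_eq_add hq1 h (u := 1) (v := -2) (by ring)) h
      rcases hq.dvd_or_dvd hq2 with hq2 | hq2
      · rcases hq.dvd_or_dvd hq2 with hq2 | hq2
        · rcases hq.dvd_or_dvd hq2 with hq2 | hq2
          · rcases hq.dvd_or_dvd hq2 with hq2 | hq2
            · exfalso
              have : q ∣ 2 * s := dvd_of_eq_add hq1 hq2 (u := 1) (v := -1) (by ring)
              exact (hq.dvd_or_dvd this).elim n2 ns
            · exact (ns hq2).elim
          · have : q ∣ 3 * s := dvd_of_eq_add hq1 hq2 (u := 1) (v := -1) (by ring)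
            exact (hq.dvd_or_dvd this).resolve_right ns
        · exact (ns (dvd_of_eq_add hq1 hq2 (u := 1) (v := -1) (by ring))).elim
      · exfalso
        have : q ∣ 2 * (2 * s) := dvd_of_eq_add hq1 hq2 (u := 1) (v := -1) (by ring)
        exact (hq.dvd_or_dvd this).elim n2 fun h => (hq.dvd_or_dvd h).elim n2 ns)
  have hm24 : m % 24 = 1 := by omega
  have hm0 : 0 < m := by rcases hm1 with rfl | rfl <;> omega
  have hv : v ≠ 0 := by rintro rfl; simp at h1; omega
  have hv8 := mul_sq_emod_eight hm24 v
  have h1' : r + 2 * s = d * (m * v ^ 2) := by rw [h1]; ring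
  have hT : 0 < m * v ^ 2 := by positivity
  have hd1 : d = 1 := by
    generalize m * v ^ 2 = T at *
    rcases dvd_six_cases hd (by norm_num) with h | h | h | ⟨-, h | h⟩
    · exact h
    all_goals first | omega | (subst h; omega)
  subst hd1
  have hrs2 : SqUpTo p (r + 2 * s) := ⟨m, v, hm1, hv, by rw [h1']; ring⟩
  refine (not_sqUpTo_prime hmod hr (r := s - r) (s := s)).2 ?_
  refine SqUpTo.of_mul (b := -r * (r + 2 * s)) hp ?_ (hr1.mul hp.ne_zero hrs2)
  convert hF' using 1; ring

theorem curve_case_two {p : ℕ} [Fact p.Prime] (hmod : p % 24 = 1)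
    (hr : ¬∃ w : ZMod p, w ^ 4 - 2 * w ^ 2 - 2 = 0) {r k s w : ℤ} (hk : r = 2 * k)
    (hc : IsCoprime r s) (hw : w ≠ 0)
    (hF : r * s * (r ^ 2 - s ^ 2) * (r ^ 2 - 4 * s ^ 2) = p * w ^ 2) (hs : SqUpTo p s)
    (hk1 : SqUpTo p k) : False := by
  have hp : Prime (p : ℤ) := Nat.prime_iff_prime_int.mp Fact.out
  have hp0 : (0 : ℤ) < p := by exact_mod_cast (Fact.out (p := p.Prime)).pos
  have hm : (p : ℤ) % 24 = 1 := by omega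
  have had : Admissible (p : ℤ) := Admissible.of_nat_prime Fact.out hmod
  have hF' : SqUpTo p (r * s * (r ^ 2 - s ^ 2) * (r ^ 2 - 4 * s ^ 2)) :=
    ⟨p, w, Or.inr rfl, hw, hF⟩
  have hA : SqUpTo p (2 * ((r ^ 2 - s ^ 2) * (r ^ 2 - 4 * s ^ 2))) :=
    SqUpTo.of_mul (b := k * s) hp (by convert hF' using 1; rw [hk]; ring)
      (hk1.mul hp.ne_zero hs)
  have hs0 := hs.pos hp0
  have hk0 := hk1.pos hp0
  have hk8 := hk1.emod hm
  have hs8 := hs.emod hm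
  have hE := hc.emod_two
  have hodd : k % 2 = 1 := by
    by_contra hev
    obtain ⟨ρ, rfl⟩ : (2 : ℤ) ∣ k := by omega
    obtain ⟨j, rfl⟩ : ∃ j, s = 2 * j + 1 := ⟨s / 2, by omega⟩
    have hB : SqUpTo p (2 * ((16 * ρ ^ 2 - (2 * j + 1) ^ 2) * (4 * ρ ^ 2 - (2 * j + 1) ^ 2))) :=
      SqUpTo.of_mul_sq (c := 2) hp.squarefree (by convert hA using 1; rw [hk]; ring)
    have hB8 := hB.emod hm
    have : 2 * ((16 * ρ ^ 2 - (2 * j + 1) ^ 2) * (4 * ρ ^ 2 - (2 * j + 1) ^ 2)) =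
      4 * (32 * ρ ^ 4 - 10 * ρ ^ 2 * (2 * j + 1) ^ 2 + 8 * (j ^ 2 + j) ^ 2 + 4 * (j ^ 2 + j)) + 2 := by
      ring
    omega
  have hrs : ∀ q : ℤ, Prime q → q ∣ r → q ∣ s → False :=
    fun q hq h1 h2 => hc.false_of_prime hq h1 h2
  obtain ⟨d, m, v, h1, hd, hm1⟩ := exists_eq_mul_sq_of_mul_eq (D := 3) (x := r - s)
    (y := r * s * (r + s) * (r - 2 * s) * (r + 2 * s)) had (by norm_num)
    (by rw [← hF]; ring) hw
    (fun q hq hq1 hq2 => by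
      have n2 : ¬ q ∣ 2 := not_dvd_two_of_dvd_odd hq (by omega) hq1
      have ns : ¬ q ∣ s := fun h => hrs q hq
        (dvd_of_eq_add hq1 h (u := 1) (v := 1) (by ring)) h
      rcases hq.dvd_or_dvd hq2 with hq2 | hq2
      · exfalso
        rcases hq.dvd_or_dvd hq2 with hq2 | hq2
        · rcases hq.dvd_or_dvd hq2 with hq2 | hq2
          · rcases hq.dvd_or_dvd hq2 with hq2 | hq2
            · exact ns (dvd_of_eq_add hq1 hq2 (u := -1) (v := 1) (by ring))
            · exact ns hq2
          · have : q ∣ 2 * s := dvd_of_eq_add hq1 hq2 (u := -1) (v := 1) (by ring)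
            exact (hq.dvd_or_dvd this).elim n2 ns
        · exact ns (dvd_of_eq_add hq1 hq2 (u := 1) (v := -1) (by ring))
      · have : q ∣ 3 * s := dvd_of_eq_add hq1 hq2 (u := -1) (v := 1) (by ring)
        exact (hq.dvd_or_dvd this).resolve_right ns)
  have hm24 : m % 24 = 1 := by omega
  have hv : v ≠ 0 := by rintro rfl; simp at h1; omega
  have hv8 := mul_sq_emod_eight hm24 v
  have h1' : r - s = d * (m * v ^ 2) := by rw [h1]; ring
  have hd1 : d = 1 := by
    generalize m * v ^ 2 = T at *
    rcases dvd_six_cases hd (by norm_num) with h | h | h | ⟨-, h | h⟩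
    · exact h
    all_goals first | omega | (subst h; omega)
  subst hd1
  have hrs1 : SqUpTo p (r - s) := ⟨m, v, hm1, hv, by rw [h1']; ring⟩
  obtain ⟨d, m, v, h1, hd, hm1⟩ := exists_eq_mul_sq_of_mul_eq (D := 6) (x := r + 2 * s)
    (y := r * s * (r - s) * (r + s) * (r - 2 * s)) had (by norm_num) (by rw [← hF]; ring) hw
    (fun q hq hq1 hq2 => by
      have ns : ¬ q ∣ s := fun h => hrs q hq
        (dvd_of_eq_add hq1 h (u := 1) (v := -2) (by ring)) h
      have two : q ∣ 2 → q ∣ 6 := fun h => h.trans (by norm_num)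
      rcases hq.dvd_or_dvd hq2 with hq2 | hq2
      · rcases hq.dvd_or_dvd hq2 with hq2 | hq2
        · rcases hq.dvd_or_dvd hq2 with hq2 | hq2
          · rcases hq.dvd_or_dvd hq2 with hq2 | hq2
            · have : q ∣ 2 * s := dvd_of_eq_add hq1 hq2 (u := 1) (v := -1) (by ring)
              exact two ((hq.dvd_or_dvd this).resolve_right ns)
            · exact (ns hq2).elim
          · have : q ∣ 3 * s := dvd_of_eq_add hq1 hq2 (u := 1) (v := -1) (by ring)
            exact ((hq.dvd_or_dvd this).resolve_right ns).trans (by norm_num)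
        · exact (ns (dvd_of_eq_add hq1 hq2 (u := 1) (v := -1) (by ring))).elim
      · have : q ∣ 2 * (2 * s) := dvd_of_eq_add hq1 hq2 (u := 1) (v := -1) (by ring)
        exact two ((hq.dvd_or_dvd this).elim id fun h => (hq.dvd_or_dvd h).resolve_right ns))
  have hrs2 : SqUpTo p (r + 2 * s) :=
    sqUpTo_of_emod_sixteen hm (by omega) (by omega) hd hm1 h1 (by omega)
  refine (not_sqUpTo_prime hmod hr (r := r) (s := s)).2 ?_
  refine SqUpTo.of_mul (b := (r - s) * (r + 2 * s)) hp ?_ (hrs1.mul hp.ne_zero hrs2)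
  convert hF' using 1; ring

theorem curve_case_neg_two {p : ℕ} [Fact p.Prime] (hmod : p % 24 = 1)
    (hr : ¬∃ w : ZMod p, w ^ 4 - 2 * w ^ 2 - 2 = 0) {r k s w : ℤ} (hk : r = 2 * k)
    (hc : IsCoprime r s) (hw : w ≠ 0)
    (hF : r * s * (r ^ 2 - s ^ 2) * (r ^ 2 - 4 * s ^ 2) = p * w ^ 2) (hs : SqUpTo p s)
    (hk1 : SqUpTo p (-k)) : False := by
  have hp : Prime (p : ℤ) := Nat.prime_iff_prime_int.mp Fact.out
  have hp0 : (0 : ℤ) < p := by exact_mod_cast (Fact.out (p := p.Prime)).pos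
  have hm : (p : ℤ) % 24 = 1 := by omega
  have had : Admissible (p : ℤ) := Admissible.of_nat_prime Fact.out hmod
  have hF' : SqUpTo p (r * s * (r ^ 2 - s ^ 2) * (r ^ 2 - 4 * s ^ 2)) :=
    ⟨p, w, Or.inr rfl, hw, hF⟩
  have hA : SqUpTo p (-2 * ((r ^ 2 - s ^ 2) * (r ^ 2 - 4 * s ^ 2))) :=
    SqUpTo.of_mul (b := -k * s) hp (by convert hF' using 1; rw [hk]; ring)
      (hk1.mul hp.ne_zero hs)
  have hs0 := hs.pos hp0
  have hk0 := hk1.pos hp0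
  have hk8 := hk1.emod hm
  have hs8 := hs.emod hm
  have hE := hc.emod_two
  have hodd : k % 2 = 1 := by
    by_contra hev
    obtain ⟨ρ, rfl⟩ : (2 : ℤ) ∣ k := by omega
    obtain ⟨j, rfl⟩ : ∃ j, s = 2 * j + 1 := ⟨s / 2, by omega⟩
    have hB : SqUpTo p (-2 * ((16 * ρ ^ 2 - (2 * j + 1) ^ 2) * (4 * ρ ^ 2 - (2 * j + 1) ^ 2))) :=
      SqUpTo.of_mul_sq (c := 2) hp.squarefree (by convert hA using 1; rw [hk]; ring)
    have hB8 := hB.emod hm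
    have : -2 * ((16 * ρ ^ 2 - (2 * j + 1) ^ 2) * (4 * ρ ^ 2 - (2 * j + 1) ^ 2)) =
      -4 * (32 * ρ ^ 4 - 10 * ρ ^ 2 * (2 * j + 1) ^ 2 + 8 * (j ^ 2 + j) ^ 2 + 4 * (j ^ 2 + j)) - 2 := by
      ring
    omega
  have hrs : ∀ q : ℤ, Prime q → q ∣ r → q ∣ s → False :=
    fun q hq h1 h2 => hc.false_of_prime hq h1 h2
  obtain ⟨d, m, v, h1, hd, hm1⟩ := exists_eq_mul_sq_of_mul_eq (D := 6) (x := 2 * s - r)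
    (y := -r * s * (r - s) * (r + s) * (r + 2 * s)) had (by norm_num) (by rw [← hF]; ring) hw
    (fun q hq hq1 hq2 => by
      have ns : ¬ q ∣ s := fun h => hrs q hq
        (dvd_of_eq_add hq1 h (u := -1) (v := 2) (by ring)) h
      have two : q ∣ 2 → q ∣ 6 := fun h => h.trans (by norm_num)
      rcases hq.dvd_or_dvd hq2 with hq2 | hq2
      · rcases hq.dvd_or_dvd hq2 with hq2 | hq2
        · rcases hq.dvd_or_dvd hq2 with hq2 | hq2
          · rcases hq.dvd_or_dvd hq2 with hq2 | hq2
            · have : q ∣ 2 * s := dvd_of_eq_add hq1 hq2 (u := 1) (v := -1) (by ring)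
              exact two ((hq.dvd_or_dvd this).resolve_right ns)
            · exact (ns hq2).elim
          · exact (ns (dvd_of_eq_add hq1 hq2 (u := 1) (v := 1) (by ring))).elim
        · have : q ∣ 3 * s := dvd_of_eq_add hq1 hq2 (u := 1) (v := 1) (by ring)
          exact ((hq.dvd_or_dvd this).resolve_right ns).trans (by norm_num)
      · have : q ∣ 2 * (2 * s) := dvd_of_eq_add hq1 hq2 (u := 1) (v := 1) (by ring)
        exact two ((hq.dvd_or_dvd this).elim id fun h => (hq.dvd_or_dvd h).resolve_right ns))
  have hrs2 : SqUpTo p (2 * s - r) :=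
    sqUpTo_of_emod_sixteen hm (by omega) (by omega) hd hm1 h1 (by omega)
  refine (not_sqUpTo_prime hmod hr (r := -2 * (r - s)) (s := r + 2 * s)).1 ?_
  have hG : SqUpTo p (-r * (r - s) * (r + s) * (r + 2 * s)) :=
    SqUpTo.of_mul (b := s * (2 * s - r)) hp (by convert hF' using 1; ring)
      (hs.mul hp.ne_zero hrs2)
  have := hG.mul hp.ne_zero (b := 6 ^ 2) ⟨1, 6, Or.inl rfl, by norm_num, by norm_num⟩
  have h0 := hG.ne_zero hp.ne_zero
  convert this using 1; ring

theorem curve_coprime_pos {p : ℕ} [Fact p.Prime] (hmod : p % 24 = 1)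
    (hr : ¬∃ w : ZMod p, w ^ 4 - 2 * w ^ 2 - 2 = 0) {r s w : ℤ} (hs0 : 0 < s)
    (hc : IsCoprime r s) (hw : w ≠ 0)
    (hF : r * s * (r ^ 2 - s ^ 2) * (r ^ 2 - 4 * s ^ 2) = p * w ^ 2) : False := by
  have hp : Prime (p : ℤ) := Nat.prime_iff_prime_int.mp Fact.out
  have hp0 : (0 : ℤ) < p := by exact_mod_cast (Fact.out (p := p.Prime)).pos
  have had : Admissible (p : ℤ) := Admissible.of_nat_prime Fact.out hmod
  have hF' : SqUpTo p (r * s * (r ^ 2 - s ^ 2) * (r ^ 2 - 4 * s ^ 2)) :=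
    ⟨p, w, Or.inr rfl, hw, hF⟩
  have hrs : ∀ q : ℤ, Prime q → q ∣ r → q ∣ s → False :=
    fun q hq h1 h2 => hc.false_of_prime hq h1 h2
  obtain ⟨d, m, v, h1, hd, hm1⟩ := exists_eq_mul_sq_of_mul_eq (D := 1) (x := s)
    (y := r * (r ^ 2 - s ^ 2) * (r ^ 2 - 4 * s ^ 2)) had (by norm_num) (by rw [← hF]; ring) hw
    (fun q hq hq1 hq2 => by
      exfalso
      have nr : ¬ q ∣ r := fun h => hrs q hq h hq1
      rcases hq.dvd_or_dvd hq2 with hq2 | hq2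
      · rcases hq.dvd_or_dvd hq2 with hq2 | hq2
        · exact nr hq2
        · exact nr (hq.dvd_of_dvd_pow (n := 2)
            (dvd_of_eq_add hq1 hq2 (u := s) (v := 1) (by ring)))
      · exact nr (hq.dvd_of_dvd_pow (n := 2)
          (dvd_of_eq_add hq1 hq2 (u := 4 * s) (v := 1) (by ring))))
  have hv : v ≠ 0 := by rintro rfl; simp at h1; omega
  have hm0 : 0 < m := by omega
  have hd1 : d = 1 := by
    have hT : 0 < m * v ^ 2 := by positivity
    have h1' : s = d * (m * v ^ 2) := by rw [h1]; ring
    rcases dvd_six_cases hd (by norm_num) with h | h | h | h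
    · exact h
    · subst h; omega
    · omega
    · omega
  have hs : SqUpTo p s := ⟨m, v, hm1, hv, by rw [h1, hd1]; ring⟩
  clear hd1 hm0 hv hm1 hd h1 v m d
  obtain ⟨d, m, v, h1, hd, hm1⟩ := exists_eq_mul_sq_of_mul_eq (D := 2) (x := r)
    (y := s * (r ^ 2 - s ^ 2) * (r ^ 2 - 4 * s ^ 2)) had (by norm_num) (by rw [← hF]; ring) hw
    (fun q hq hq1 hq2 => by
      have ns : ¬ q ∣ s := fun h => hrs q hq hq1 h
      rcases hq.dvd_or_dvd hq2 with hq2 | hq2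
      · exfalso
        rcases hq.dvd_or_dvd hq2 with hq2 | hq2
        · exact ns hq2
        · exact ns (hq.dvd_of_dvd_pow (n := 2)
            (dvd_of_eq_add hq1 hq2 (u := r) (v := -1) (by ring)))
      · have : q ∣ (2 * s) ^ 2 := dvd_of_eq_add hq1 hq2 (u := r) (v := -1) (by ring)
        exact (hq.dvd_or_dvd (hq.dvd_of_dvd_pow this)).resolve_right ns)
  have hr0 : r ≠ 0 := by
    rintro rfl
    exact hF'.ne_zero hp.ne_zero (by ring)
  have hv : v ≠ 0 := by rintro rfl; simp at h1; exact hr0 h1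
  have hS : SqUpTo p (m * v ^ 2) := ⟨m, v, hm1, hv, rfl⟩
  have h1' : r = d * (m * v ^ 2) := by rw [h1]; ring
  rcases dvd_six_cases hd (by norm_num) with h | h | ⟨-, h | h⟩ | ⟨h, -⟩
  · exact curve_case_one hmod hr hF' hs (by rwa [h1', h, one_mul])
  · exact curve_case_neg_one hmod hr hc hw hF hs (by rwa [h1', h, neg_one_mul, neg_neg])
  · exact curve_case_two hmod hr (k := m * v ^ 2) (by rw [h1', h]) hc hw hF hs hS
  · exact curve_case_neg_two hmod hr (k := -(m * v ^ 2)) (by rw [h1', h]; ring) hc hw hF hs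
      (by rwa [neg_neg])
  · omega

/-- For a prime `p ≡ 1 (mod 24)` such that `2` is a fourth power mod `p` but
`X⁴ − 2X² − 2` has no root mod `p` (i.e. `p` splits completely in `ℚ(2^{1/4})` and not in
`ℚ(√(1+√3))`), every rational point on `C_p : y² = x(x² − p²)(x² − 4p²)` has `y = 0`. -/
theorem rational_points_Cp_of_one_mod_24_case_a (p : ℕ) (hp : Nat.Prime p) (hmod : p % 24 = 1)
    (h2 : ∃ z : ZMod p, z ^ 4 = 2)
    (h3 : ¬∃ w : ZMod p, w ^ 4 - 2 * w ^ 2 - 2 = 0)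
    (x y : ℚ) (h : y ^ 2 = x * (x ^ 2 - (p : ℚ) ^ 2) * (x ^ 2 - 4 * (p : ℚ) ^ 2)) :
    y = 0 ∧ (x = 0 ∨ x = p ∨ x = -p ∨ x = 2 * p ∨ x = -(2 * p)) := by
  have : Fact p.Prime := ⟨hp⟩
  have hp0 : (p : ℚ) ≠ 0 := by exact_mod_cast hp.ne_zero
  have hy : y = 0 := by
    by_contra hy
    set t : ℚ := x / p with ht
    have hx : x = p * t := by rw [ht]; field_simp
    set c : ℚ := y * t.den ^ 3 / p ^ 3 with hc
    have hc0 : c ≠ 0 := by positivity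
    have key : (t.num : ℚ) * t.den * (t.num ^ 2 - t.den ^ 2) * (t.num ^ 2 - 4 * t.den ^ 2) =
        p * c ^ 2 := by
      have hn : (t.num : ℚ) = t * t.den := by rw [Rat.mul_den_eq_num]
      have : p * c ^ 2 = y ^ 2 * t.den ^ 6 / p ^ 5 := by rw [hc]; field_simp
      rw [this, h, hx, hn]
      field_simp
    have keyZ : (t.num * t.den * (t.num ^ 2 - (t.den : ℤ) ^ 2) *
        (t.num ^ 2 - 4 * (t.den : ℤ) ^ 2)) * (c.den : ℤ) ^ 2 = p * c.num ^ 2 := by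
      have : (c.num : ℚ) = c * c.den := by rw [Rat.mul_den_eq_num]
      have : ((t.num : ℚ) * t.den * (t.num ^ 2 - t.den ^ 2) * (t.num ^ 2 - 4 * t.den ^ 2)) *
          c.den ^ 2 = p * c.num ^ 2 := by rw [key, this]; ring
      exact_mod_cast this
    have hpp : Prime (p : ℤ) := Nat.prime_iff_prime_int.mp hp
    obtain ⟨w, hw⟩ : (c.den : ℤ) ∣ c.num :=
      dvd_of_sq_dvd_mul_sq hpp.squarefree (Dvd.intro_left _ keyZ)
    have hcdZ : (c.den : ℤ) ≠ 0 := by exact_mod_cast c.den_ne_zero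
    refine curve_coprime_pos hmod h3 (r := t.num) (s := t.den) (w := w)
      (by exact_mod_cast t.den_pos) (Rat.isCoprime_num_den t) ?_ ?_
    · rintro rfl
      exact hc0 (Rat.num_eq_zero.mp (by simpa using hw))
    · rw [hw] at keyZ
      exact mul_right_cancel₀ (pow_ne_zero 2 hcdZ) (by rw [keyZ]; ring)
  refine ⟨hy, ?_⟩
  rw [hy] at h
  have h0 : x * ((x - p) * ((x + p) * ((x - 2 * p) * (x + 2 * p)))) = 0 := by
    linear_combination -h
  simp only [mul_eq_zero] at h0
  rcases h0 with h | h | h | h | h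
  · exact Or.inl h
  · exact Or.inr (Or.inl (by linarith))
  · exact Or.inr (Or.inr (Or.inl (by linarith)))
  · exact Or.inr (Or.inr (Or.inr (Or.inl (by linarith))))
  · exact Or.inr (Or.inr (Or.inr (Or.inr (by linarith))))
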